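/- arXiv:1104.2662 — 2 statements merged into one kernel-verified Lean document; each statement's English description precedes it below -/
import Mathlib

section
/- For every integer N ≥ 1, dim_ℚ ℚ[x_1, x_2, x_3]/(x_1 + x_2 + x_3, x_1^N, x_2^N, x_3^N) = ⌈3N²/4⌉. Equivalently, dim_ℚ ℚ[x, y]/(x^N, y^N, (x+y)^N) = ⌈3N²/4⌉. Consequently, the naive limit lim_{N→∞} dim_ℚ(R_ℚ/(x_1^N, x_2^N, x_3^N))/N² for R_ℚ = ℚ[x_1, x_2, x_3]/(x_1 + x_2 + x_3) equals 3/4. -/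
open MvPolynomial Filter

/-- `Dcolength F s k` : dimension over `F` of
`F[y_1,…,y_s] / (y_1^{k_1}, …, y_s^{k_s}, (y_1+⋯+y_s)^{k_{s+1}})`,
i.e. the quantity `D_F(k_1, …, k_{s+1})` of Han–Monsky (with `s+1` arguments
and `s` variables). -/
noncomputable def Dcolength (F : Type) [CommRing F] (s : ℕ) (k : Fin (s+1) → ℕ) : ℕ :=
  Module.finrank F (MvPolynomial (Fin s) F ⧸
    Ideal.span (Set.range (fun i : Fin s =>
        (X i : MvPolynomial (Fin s) F) ^ k i.castSucc) ∪
      {(∑ i : Fin s, (X i : MvPolynomial (Fin s) F)) ^ k (Fin.last s)}))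

/-- Dimension over `F` of `R/𝔪^{[q]}` where
`R = F[x_1,…,x_s]/(x_1^{d_1}+⋯+x_s^{d_s})` and `𝔪^{[q]} = (x_1^q,…,x_s^q)`. -/
noncomputable def hkColength (F : Type) [CommRing F] (s : ℕ) (d : Fin s → ℕ) (q : ℕ) : ℕ :=
  Module.finrank F (MvPolynomial (Fin s) F ⧸
    Ideal.span (insert (∑ i : Fin s, (X i : MvPolynomial (Fin s) F) ^ d i)
      (Set.range fun i : Fin s => (X i : MvPolynomial (Fin s) F) ^ q)))

/-- The Han–Monsky function `g_λ(x_1,…,x_s)`. -/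
noncomputable def gl (s : ℕ) (x : Fin s → ℝ) (lam : ℤ) : ℝ :=
  ∑ ε ∈ Finset.univ.filter
      (fun ε : Fin s → Bool =>
        2 * (lam : ℝ) ≤ ∑ i, (if ε i then (1:ℝ) else -1) * x i),
    (∏ i, (if ε i then (1:ℝ) else -1)) *
      ((∑ i, (if ε i then (1:ℝ) else -1) * x i) - 2 * (lam : ℝ)) ^ (s - 1)

/-- The Han–Monsky function `g(x_1,…,x_s) = (1/(2^{s-1}(s-1)!)) Σ_λ g_λ(x)`. -/
noncomputable def gfun (s : ℕ) (x : Fin s → ℝ) : ℝ :=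
  (1 / (2 ^ (s-1) * (Nat.factorial (s-1)))) * ∑' lam : ℤ, gl s x lam


lemma s9_key (n e : ℕ) (hen : e ≤ n) (c : Polynomial ℚ) (hc : c.natDegree ≤ e)
    (h : ∀ l, e + 1 ≤ l → l ≤ 2 * e + 1 →
      (c * (1 + Polynomial.X) ^ (n + 1)).coeff l = 0) : c = 0 := by
  by_contra hc0
  set u : Polynomial ℚ := 1 + Polynomial.X with hu
  have hu' : u = Polynomial.X + Polynomial.C 1 := by rw [hu, add_comm]; simp
  have hud : Polynomial.derivative u = 1 := by simp [hu]
  have humon : (u ^ (n+1)).Monic := by rw [hu']; exact (Polynomial.monic_X_add_C 1).pow _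
  have hudeg : ∀ k, (u ^ k).natDegree = k := by
    intro k; rw [hu', Polynomial.natDegree_pow, Polynomial.natDegree_X_add_C, mul_one]
  set g := c * u ^ (n + 1) with hg
  have hg0 : g ≠ 0 := mul_ne_zero hc0 humon.ne_zero
  have hgdeg : g.natDegree = c.natDegree + (n + 1) := by
    rw [hg, Polynomial.natDegree_mul hc0 humon.ne_zero, hudeg]
  set a : Polynomial ℚ := ∑ l ∈ Finset.range (e + 1), Polynomial.monomial l (g.coeff l) with ha
  have hac : ∀ l, a.coeff l = if l < e + 1 then g.coeff l else 0 := by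
    intro l
    simp [ha, Polynomial.finsetSum_coeff, Polynomial.coeff_monomial]
  have hadeg : a.natDegree ≤ e := by
    rw [Polynomial.natDegree_le_iff_coeff_eq_zero]
    intro l hl
    rw [hac, if_neg (by omega)]
  have hdiv : (Polynomial.X : Polynomial ℚ) ^ (2 * e + 2) ∣ g - a := by
    rw [Polynomial.X_pow_dvd_iff]
    intro l hl
    rw [Polynomial.coeff_sub, hac]
    split_ifs with h1
    · simp
    · rw [h l (by omega) (by omega)]; simp
  obtain ⟨b, hb⟩ := hdiv
  by_cases ha0 : a = 0
  · have h1 : (Polynomial.X : Polynomial ℚ) ^ (2 * e + 2) ∣ c := by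
      have h2 : (Polynomial.X : Polynomial ℚ) ^ (2 * e + 2) ∣ c * u ^ (n + 1) := by
        rw [ha0, sub_zero] at hb; exact ⟨b, hb⟩
      refine IsCoprime.dvd_of_dvd_mul_right (IsCoprime.pow ?_) h2
      exact ⟨-1, 1, by rw [hu]; ring⟩
    have := Polynomial.natDegree_le_of_dvd h1 hc0
    rw [Polynomial.natDegree_X_pow] at this
    omega
  · have hW : Polynomial.wronskian a g ≠ 0 := by
      intro hw
      have h1 : a * Polynomial.derivative g = Polynomial.derivative a * g := by
        rw [Polynomial.wronskian] at hw; exact sub_eq_zero.mp hw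
      obtain ⟨m, hm⟩ : ∃ m, g.natDegree = m + 1 := ⟨c.natDegree + n, by omega⟩
      have h2 := congrArg (fun p => Polynomial.coeff (p * Polynomial.X) (a.natDegree + g.natDegree)) h1
      have e1 : a * Polynomial.derivative g * Polynomial.X
          = a * (Polynomial.derivative g * Polynomial.X) := by ring
      have e2 : Polynomial.derivative a * g * Polynomial.X
          = (Polynomial.derivative a * Polynomial.X) * g := by ring
      have key : ∀ p : Polynomial ℚ, ∀ k,
          (Polynomial.derivative p * Polynomial.X).coeff k = p.coeff k * k := by
        intro p k
        cases k with
        | zero => simp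
        | succ k => rw [Polynomial.coeff_mul_X, Polynomial.coeff_derivative]; push_cast; ring
      have kd : ∀ p : Polynomial ℚ, 
          (Polynomial.derivative p * Polynomial.X).natDegree ≤ p.natDegree := by
        intro p
        rw [Polynomial.natDegree_le_iff_coeff_eq_zero]
        intro l hl
        rw [key, Polynomial.coeff_eq_zero_of_natDegree_lt hl, zero_mul]
      simp only [e1, e2] at h2
      rw [Polynomial.coeff_mul_add_eq_of_natDegree_le le_rfl (kd g),
        Polynomial.coeff_mul_add_eq_of_natDegree_le (kd a) le_rfl, key, key] at h2
      have la : a.coeff a.natDegree ≠ 0 := by simpa using ha0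
      have lg : g.coeff g.natDegree ≠ 0 := by simpa using hg0
      have h3 : (g.natDegree : ℚ) = a.natDegree := by
        have : a.coeff a.natDegree * g.coeff g.natDegree * ((g.natDegree : ℚ) - a.natDegree) = 0 := by
          linear_combination h2
        rcases mul_eq_zero.mp this with h | h
        · exact absurd h (mul_ne_zero la lg)
        · linarith
      have h4 : g.natDegree = a.natDegree := by exact_mod_cast h3
      omega
    have d1 : u ^ n ∣ Polynomial.wronskian a g := by
      refine ⟨a * (Polynomial.derivative c * u + c * (n + 1)) - Polynomial.derivative a * c * u, ?_⟩
      rw [Polynomial.wronskian, hg, Polynomial.derivative_mul, Polynomial.derivative_pow_succ, hud]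
      simp only [map_add, map_natCast, map_one]
      ring
    have d2 : (Polynomial.X : Polynomial ℚ) ^ (2 * e + 1) ∣ Polynomial.wronskian a g := by
      have : a = g - Polynomial.X ^ (2 * e + 1 + 1) * b := by rw [← hb]; ring
      refine ⟨-(Polynomial.X * b * Polynomial.derivative g)
        + ((2 * (e : Polynomial ℚ) + 1 + 1) * b + Polynomial.X * Polynomial.derivative b) * g, ?_⟩
      rw [Polynomial.wronskian, this]
      simp only [Polynomial.derivative_sub, Polynomial.derivative_mul,
        Polynomial.derivative_X_pow_succ]
      simp only [map_add, map_natCast, map_one]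
      push_cast
      ring
    have d3 : Polynomial.X ^ (2 * e + 1) * u ^ n ∣ Polynomial.wronskian a g :=
      IsCoprime.mul_dvd (IsCoprime.pow ⟨-1, 1, by rw [hu]; ring⟩) d2 d1
    have h5 := Polynomial.natDegree_le_of_dvd d3 hW
    have h6 := Polynomial.natDegree_wronskian_lt_add hW
    rw [Polynomial.natDegree_mul (by simp) (by intro h0; apply humon.ne_zero; rw [pow_succ, h0, zero_mul]),
      hudeg, Polynomial.natDegree_X_pow] at h5
    omega

lemma s9_exists (n e j : ℕ) (hen : e ≤ n) :
    ∃ c : Polynomial ℚ, c.natDegree ≤ e ∧ ∀ l, e + 1 ≤ l → l ≤ 2 * e + 1 →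
      (c * (1 + Polynomial.X) ^ (n + 1)).coeff l = if l = j then 1 else 0 := by
  let f : Polynomial.degreeLT ℚ (e + 1) →ₗ[ℚ] (Fin (e + 1) → ℚ) :=
    LinearMap.pi fun i => (Polynomial.lcoeff ℚ (e + 1 + i)) ∘ₗ
      (LinearMap.mulRight ℚ ((1 + Polynomial.X) ^ (n + 1))) ∘ₗ
        (Polynomial.degreeLT ℚ (e + 1)).subtype
  have hf : ∀ c i, f c i = ((c : Polynomial ℚ) * (1 + Polynomial.X) ^ (n + 1)).coeff (e + 1 + i) :=
    fun c i => rfl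
  have hdeg : ∀ c : Polynomial.degreeLT ℚ (e + 1), (c : Polynomial ℚ).natDegree ≤ e := by
    intro c
    have := Polynomial.mem_degreeLT.mp c.2
    rw [Polynomial.natDegree_le_iff_coeff_eq_zero]
    intro l hl
    exact Polynomial.coeff_eq_zero_of_degree_lt (lt_of_lt_of_le this (by exact_mod_cast hl))
  have : FiniteDimensional ℚ (Polynomial.degreeLT ℚ (e + 1)) :=
    Module.Finite.equiv (Polynomial.degreeLTEquiv ℚ (e + 1)).symm
  have hinj : Function.Injective f := by
    rw [injective_iff_map_eq_zero]
    intro c hc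
    apply Subtype.ext
    refine s9_key n e hen _ (hdeg c) ?_
    intro l h1 h2
    have := congrFun hc ⟨l - (e + 1), by omega⟩
    rw [hf] at this
    simpa [Nat.add_sub_cancel' h1] using this
  have hsurj := (LinearMap.injective_iff_surjective_of_finrank_eq_finrank
    (LinearEquiv.finrank_eq (Polynomial.degreeLTEquiv ℚ (e + 1)))).mp hinj
  obtain ⟨c, hc⟩ := hsurj (fun i => if e + 1 + (i : ℕ) = j then 1 else 0)
  refine ⟨c, hdeg c, fun l h1 h2 => ?_⟩
  have := congrFun hc ⟨l - (e + 1), by omega⟩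
  rw [hf] at this
  simpa [Nat.add_sub_cancel' h1] using this

/-- the ideal `(x^N, y^N, (x+y)^N)` -/
noncomputable def s9I (N : ℕ) : Ideal (MvPolynomial (Fin 2) ℚ) :=
  Ideal.span {X 0 ^ N, X 1 ^ N, (X 0 + X 1) ^ N}

lemma s9I_x (N : ℕ) : (X 0 ^ N : MvPolynomial (Fin 2) ℚ) ∈ s9I N :=
  Ideal.subset_span (by simp)
lemma s9I_y (N : ℕ) : (X 1 ^ N : MvPolynomial (Fin 2) ℚ) ∈ s9I N :=
  Ideal.subset_span (by simp)
lemma s9I_s (N : ℕ) : ((X 0 + X 1) ^ N : MvPolynomial (Fin 2) ℚ) ∈ s9I N :=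
  Ideal.subset_span (by simp)

lemma s9_sum_homog (N : ℕ) : ((X 0 + X 1) ^ N : MvPolynomial (Fin 2) ℚ).IsHomogeneous N := by
  have := ((isHomogeneous_X ℚ (0 : Fin 2)).add (isHomogeneous_X ℚ (1 : Fin 2))).pow N
  simpa using this

lemma s9_mon (a b : ℕ) (r : ℚ) :
    (monomial (fun₀ | (0 : Fin 2) => a | 1 => b) r : MvPolynomial (Fin 2) ℚ)
      = r • (X 0 ^ a * X 1 ^ b) := by
  rw [Finsupp.update_eq_add_single (by simp), monomial_single_add, ← C_mul_X_pow_eq_monomial,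
    smul_eq_C_mul]
  ring

/-- index set of standard monomials -/
def s9S (N : ℕ) : Finset (Σ _ : ℕ, ℕ) :=
  (Finset.range N).sigma (fun j => Finset.range (N - (j + 1) / 2))

lemma s9_span (N : ℕ) (hN : 1 ≤ N) :
    Submodule.span ℚ (Set.range fun s : s9S N =>
      Ideal.Quotient.mk (s9I N) (X 0 ^ s.1.1 * X 1 ^ s.1.2)) = ⊤ := by
  set W := Submodule.span ℚ (Set.range fun s : s9S N =>
      Ideal.Quotient.mk (s9I N) (X 0 ^ s.1.1 * X 1 ^ s.1.2)) with hW
  set V : Submodule ℚ (MvPolynomial (Fin 2) ℚ) :=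
    W.comap (Ideal.Quotient.mkₐ ℚ (s9I N)).toLinearMap with hV
  have memV : ∀ p, p ∈ V ↔ Ideal.Quotient.mk (s9I N) p ∈ W := fun p => Iff.rfl
  have hIV : ∀ p ∈ s9I N, p ∈ V := by
    intro p hp
    rw [memV, Ideal.Quotient.eq_zero_iff_mem.mpr hp]
    exact W.zero_mem
  have hx : ∀ j k, N ≤ j → X 0 ^ j * X 1 ^ k ∈ V := by
    intro j k h
    apply hIV
    exact Ideal.mul_mem_right _ _ (Ideal.mem_of_dvd _ (pow_dvd_pow _ h) (s9I_x N))
  have hy : ∀ j k, N ≤ k → X 0 ^ j * X 1 ^ k ∈ V := by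
    intro j k h
    apply hIV
    exact Ideal.mul_mem_left _ _ (Ideal.mem_of_dvd _ (pow_dvd_pow _ h) (s9I_y N))
  have hS : ∀ j k, j < N → k < N - (j + 1) / 2 → X 0 ^ j * X 1 ^ k ∈ V := by
    intro j k h1 h2
    rw [memV]
    exact Submodule.subset_span ⟨⟨⟨j, k⟩, by simp [s9S, h1, h2]⟩, rfl⟩
  have hmon : ∀ j k, X 0 ^ j * X 1 ^ k ∈ V := by
    intro j k
    by_cases h1 : N ≤ j
    · exact hx j k h1
    by_cases h2 : N ≤ k
    · exact hy j k h2
    by_cases h3 : k < N - (j + 1) / 2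
    · exact hS j k (by omega) h3
    obtain ⟨n, rfl⟩ : ∃ n, N = n + 1 := ⟨N - 1, by omega⟩
    obtain ⟨e, he⟩ : ∃ e, j + k = e + (n + 1) := ⟨j + k - (n + 1), by omega⟩
    obtain ⟨c, hc, hcoef⟩ := s9_exists n e j (by omega)
    have hud : ((1 + Polynomial.X : Polynomial ℚ) ^ (n + 1)).natDegree ≤ n + 1 := by
      have : (1 + Polynomial.X : Polynomial ℚ) = Polynomial.X + Polynomial.C 1 := by
        rw [add_comm]; simp
      rw [this, Polynomial.natDegree_pow, Polynomial.natDegree_X_add_C, mul_one]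
    have hm := Polynomial.homogenize_mul c ((1 + Polynomial.X) ^ (n + 1)) hc hud
    rw [Polynomial.homogenize_eq_of_isHomogeneous (s9_sum_homog (n + 1))
      (by simp [add_comm])] at hm
    have hmem : Polynomial.homogenize (c * (1 + Polynomial.X) ^ (n + 1)) (e + (n + 1)) ∈ V := by
      rw [hm]
      exact hIV _ (Ideal.mul_mem_left _ _ (s9I_s _))
    rw [Polynomial.homogenize] at hmem
    simp only [s9_mon] at hmem
    have hjk : (j, k) ∈ Finset.HasAntidiagonal.antidiagonal (e + (n + 1)) := by simp [he]
    rw [← Finset.add_sum_erase _ _ hjk] at hmem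
    have hrest : ∑ x ∈ (Finset.HasAntidiagonal.antidiagonal (e + (n + 1))).erase (j, k),
        (c * (1 + Polynomial.X) ^ (n + 1)).coeff x.1 • 
          (X 0 ^ x.1 * X 1 ^ x.2 : MvPolynomial (Fin 2) ℚ) ∈ V := by
      refine Submodule.sum_mem _ ?_
      rintro ⟨l, r⟩ hlr
      rw [Finset.mem_erase, Finset.HasAntidiagonal.mem_antidiagonal] at hlr
      obtain ⟨hne, hlr⟩ := hlr
      simp only at hlr ⊢
      by_cases g1 : l ≤ e
      · exact V.smul_mem _ (hy _ _ (by omega))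
      by_cases g2 : l ≤ 2 * e + 1
      · rw [hcoef l (by omega) g2, if_neg, zero_smul]
        · exact V.zero_mem
        · rintro rfl
          apply hne
          ext
          · rfl
          · simp only; omega
      · apply V.smul_mem
        by_cases g3 : n + 1 ≤ l
        · exact hx _ _ g3
        · exact hS _ _ (by omega) (by omega)
    have := (Submodule.add_mem_iff_left _ hrest).mp hmem
    simpa [hcoef j (by omega) (by omega)] using this
  have hVtop : ∀ p, p ∈ V := by
    intro p
    induction p using MvPolynomial.induction_on' with
    | monomial u a =>
      have hu : u = (fun₀ | (0 : Fin 2) => u 0 | 1 => u 1) := by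
        ext i; fin_cases i <;> simp
      rw [hu, s9_mon]
      exact V.smul_mem _ (hmon _ _)
    | add p q hp hq => exact V.add_mem hp hq
  rw [eq_top_iff]
  intro q _
  obtain ⟨p, rfl⟩ := Ideal.Quotient.mk_surjective q
  exact hVtop p

lemma s9_finite (N : ℕ) (hN : 1 ≤ N) : Module.Finite ℚ (MvPolynomial (Fin 2) ℚ ⧸ s9I N) :=
  ⟨by rw [← s9_span N hN]; exact Submodule.fg_span (Set.finite_range _)⟩

lemma s9_upper (N : ℕ) (hN : 1 ≤ N) :
    Module.finrank ℚ (MvPolynomial (Fin 2) ℚ ⧸ s9I N) ≤ (s9S N).card := by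
  rw [← finrank_top, ← s9_span N hN]
  exact (finrank_range_le_card _).trans (by simp)

/-- index set for the lower bound -/
def s9T (N : ℕ) : Finset (Σ _ : ℕ, ℕ) :=
  (Finset.range N).sigma (fun j => Finset.range (N - (j - N / 2)))

/-- relations for the lower bound -/
def s9R (N : ℕ) : Finset (Σ _ : ℕ, ℕ) :=
  (Finset.range (N / 2)).sigma (fun j => Finset.range (N / 2 - j))

/-- coefficient map -/
noncomputable def s9pi (N : ℕ) : MvPolynomial (Fin 2) ℚ →ₗ[ℚ] (s9T N → ℚ) :=
  LinearMap.pi fun t => MvPolynomial.lcoeff ℚ (fun₀ | (0 : Fin 2) => t.1.1 | 1 => t.1.2)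

lemma s9pi_apply (N : ℕ) (p) (t : s9T N) :
    s9pi N p t = coeff (fun₀ | (0 : Fin 2) => t.1.1 | 1 => t.1.2) p := rfl

lemma s9pi_surj (N : ℕ) : Function.Surjective (s9pi N) := by
  classical
  intro w
  refine ⟨∑ t, monomial (fun₀ | (0 : Fin 2) => t.1.1 | 1 => t.1.2) (w t), ?_⟩
  ext t
  rw [s9pi_apply, coeff_sum, Finset.sum_eq_single t]
  · simp
  · intro b _ hb
    rw [coeff_monomial, if_neg]
    intro h
    apply hb
    have h0 := DFunLike.congr_fun h 0
    have h1 := DFunLike.congr_fun h 1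
    simp at h0 h1
    apply Subtype.ext
    exact Sigma.ext h0 (heq_of_eq h1)
  · simp

lemma s9T_mem (N : ℕ) (t : s9T N) : t.1.1 < N ∧ t.1.2 < N ∧ t.1.1 + t.1.2 < N + N / 2 := by
  have := t.2
  simp only [s9T, Finset.mem_sigma, Finset.mem_range] at this
  omega

lemma s9_image (N : ℕ) (p) (hp : p ∈ s9I N) :
    s9pi N p ∈ Submodule.span ℚ (Set.range fun r : s9R N =>
      s9pi N (monomial (fun₀ | (0 : Fin 2) => r.1.1 | 1 => r.1.2) 1 * (X 0 + X 1) ^ N)) := by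
  rw [s9I, Ideal.mem_span_insert] at hp
  obtain ⟨a, z, hz, rfl⟩ := hp
  rw [Ideal.mem_span_pair] at hz
  obtain ⟨b, c, rfl⟩ := hz
  rw [map_add, map_add]
  have h1 : s9pi N (a * X 0 ^ N) = 0 := by
    ext t
    rw [s9pi_apply, X_pow_eq_monomial, coeff_mul_monomial', if_neg]
    · rfl
    · intro h
      have := h 0
      simp at this
      have := s9T_mem N t
      omega
  have h2 : s9pi N (b * X 1 ^ N) = 0 := by
    ext t
    rw [s9pi_apply, X_pow_eq_monomial, coeff_mul_monomial', if_neg]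
    · rfl
    · intro h
      have := h 1
      simp at this
      have := s9T_mem N t
      omega
  rw [h1, h2, zero_add, zero_add]
  induction c using MvPolynomial.induction_on' with
  | add p q hp hq => rw [add_mul, map_add]; exact Submodule.add_mem _ hp hq
  | monomial u r =>
    have hu : u = (fun₀ | (0 : Fin 2) => u 0 | 1 => u 1) := by
      ext i; fin_cases i <;> simp
    have hm : (monomial u r : MvPolynomial (Fin 2) ℚ) = r • monomial u 1 := by
      rw [smul_monomial]; simp
    rw [hm, smul_mul_assoc, map_smul]
    apply Submodule.smul_mem
    by_cases h : u 0 + u 1 < N / 2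
    · apply Submodule.subset_span
      refine ⟨⟨⟨u 0, u 1⟩, ?_⟩, ?_⟩
      · simp only [s9R, Finset.mem_sigma, Finset.mem_range]; omega
      · simp only [← hu]
    · have : s9pi N (monomial u 1 * (X 0 + X 1) ^ N) = 0 := by
        ext t
        have ht := s9T_mem N t
        rw [s9pi_apply, coeff_monomial_mul']
        split_ifs with hle
        · have l0 := hle 0
          have l1 := hle 1
          simp at l0 l1
          rw [(s9_sum_homog N).coeff_eq_zero]
          · simp
          · rw [Finsupp.degree_eq_sum, Fin.sum_univ_two]
            simp
            omega
        · rfl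
      rw [this]
      exact Submodule.zero_mem _

lemma s9_lower (N : ℕ) (hN : 1 ≤ N) :
    (s9T N).card ≤ Module.finrank ℚ (MvPolynomial (Fin 2) ℚ ⧸ s9I N) + (s9R N).card := by
  have := s9_finite N hN
  set U := Submodule.span ℚ (Set.range fun r : s9R N =>
      s9pi N (monomial (fun₀ | (0 : Fin 2) => r.1.1 | 1 => r.1.2) 1 * (X 0 + X 1) ^ N)) with hU
  have hUc : Module.finrank ℚ U ≤ (s9R N).card := (finrank_range_le_card _).trans (by simp)
  have hq := Submodule.finrank_quotient_add_finrank U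
  rw [Module.finrank_fintype_fun_eq_card, Fintype.card_coe] at hq
  let f : (MvPolynomial (Fin 2) ℚ ⧸ (s9I N).restrictScalars ℚ) →ₗ[ℚ] ((s9T N → ℚ) ⧸ U) :=
    Submodule.mapQ _ U (s9pi N) (fun p hp => s9_image N p hp)
  have hf : Function.Surjective f := by
    intro q
    obtain ⟨w, rfl⟩ := Submodule.mkQ_surjective _ q
    obtain ⟨p, rfl⟩ := s9pi_surj N w
    exact ⟨Submodule.mkQ _ p, rfl⟩
  let E : (MvPolynomial (Fin 2) ℚ ⧸ (s9I N).restrictScalars ℚ) ≃ₗ[ℚ]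
    (MvPolynomial (Fin 2) ℚ ⧸ (s9I N)) := Submodule.Quotient.restrictScalarsEquiv ℚ (s9I N)
  have hle : Module.finrank ℚ ((s9T N → ℚ) ⧸ U) ≤ 
      Module.finrank ℚ (MvPolynomial (Fin 2) ℚ ⧸ s9I N) :=
    LinearMap.finrank_le_finrank_of_surjective (f := f ∘ₗ E.symm.toLinearMap)
      (hf.comp E.symm.surjective)
  omega

lemma s9_quarter (n : ℕ) : (n + 1) * (n + 1) / 4 = n * n / 4 + (n + 1) / 2 := by
  obtain ⟨m, rfl | rfl⟩ : ∃ m, n = 2 * m ∨ n = 2 * m + 1 := ⟨n / 2, by omega⟩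
  · have e1 : (2 * m + 1) * (2 * m + 1) = 4 * (m * m + m) + 1 := by ring
    have e2 : 2 * m * (2 * m) = 4 * (m * m) := by ring
    rw [e1, e2]; omega
  · have e1 : (2 * m + 1 + 1) * (2 * m + 1 + 1) = 4 * (m * m + 2 * m + 1) := by ring
    have e2 : (2 * m + 1) * (2 * m + 1) = 4 * (m * m + m) + 1 := by ring
    rw [e1, e2]; omega

lemma s9_sum1 (N n : ℕ) (h : n ≤ N) :
    ∑ j ∈ Finset.range n, (N - (j + 1) / 2) + n * n / 4 = n * N := by
  induction n with
  | zero => simp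
  | succ n ih =>
    have := ih (by omega)
    rw [Finset.sum_range_succ, s9_quarter, Nat.succ_mul]
    omega

lemma s9_sum2 (N n : ℕ) (h : n ≤ N) :
    2 * ∑ j ∈ Finset.range n, (N - j) + n * n = 2 * (n * N) + n := by
  induction n with
  | zero => simp
  | succ n ih =>
    have := ih (by omega)
    rw [Finset.sum_range_succ]
    have e1 : (n + 1) * (n + 1) = n * n + 2 * n + 1 := by ring
    have e2 : (n + 1) * N = n * N + N := by ring
    rw [e1, e2]
    omega

lemma s9S_card (N : ℕ) : (s9S N).card = N * N - N * N / 4 := by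
  have := s9_sum1 N N le_rfl
  simp only [s9S, Finset.card_sigma, Finset.card_range]
  omega

lemma s9T_card (N : ℕ) : (s9T N).card = N * N - N * N / 4 + (s9R N).card := by
  simp only [s9T, s9R, Finset.card_sigma, Finset.card_range]
  obtain ⟨r, hr⟩ : ∃ r, N = N / 2 + r := ⟨N - N / 2, by omega⟩
  have h1 := s9_sum2 (N / 2) (N / 2) le_rfl
  have h2 := s9_sum2 N r (by omega)
  have h3 : ∑ j ∈ Finset.range N, (N - (j - N / 2))
      = N / 2 * N + ∑ j ∈ Finset.range r, (N - j) := by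
    conv_lhs => rw [show Finset.range N = Finset.range (N / 2 + r) by rw [← hr]]
    rw [Finset.sum_range_add]
    congr 1
    · rw [Finset.sum_congr rfl (g := fun _ => N)]
      · simp
      · intro x hx
        rw [Finset.mem_range] at hx
        omega
    · apply Finset.sum_congr rfl
      intro x _
      rw [Nat.add_sub_cancel_left]
  rw [h3]
  generalize ∑ j ∈ Finset.range r, (N - j) = A at *
  generalize ∑ j ∈ Finset.range (N / 2), (N / 2 - j) = B at *
  clear h3
  obtain ⟨m, rfl | rfl⟩ : ∃ m, N = 2 * m ∨ N = 2 * m + 1 := ⟨N / 2, by omega⟩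
  · have e0 : 2 * m / 2 = m := by omega
    rw [e0] at h1 hr
    rw [e0]
    obtain rfl : r = m := by omega
    have e1 : 2 * r * (2 * r) = 4 * (r * r) := by ring
    have e2 : r * (2 * r) = 2 * (r * r) := by ring
    rw [e1]
    rw [e2] at h2
    rw [e2]
    omega
  · have e0 : (2 * m + 1) / 2 = m := by omega
    rw [e0] at h1 hr
    rw [e0]
    obtain rfl : r = m + 1 := by omega
    have e1 : (2 * m + 1) * (2 * m + 1) = 4 * (m * m + m) + 1 := by ring
    have e2 : m * (2 * m + 1) = 2 * (m * m) + m := by ring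
    have e3 : (m + 1) * (2 * m + 1) = 2 * (m * m) + 3 * m + 1 := by ring
    have e4 : (m + 1) * (m + 1) = m * m + 2 * m + 1 := by ring
    rw [e1, e2]
    rw [e3, e4] at h2
    omega

lemma s9_finrank (N : ℕ) (hN : 1 ≤ N) :
    Module.finrank ℚ (MvPolynomial (Fin 2) ℚ ⧸ s9I N) = N * N - N * N / 4 := by
  have h1 := s9_upper N hN
  have h2 := s9_lower N hN
  rw [s9S_card] at h1
  rw [s9T_card] at h2
  omega

lemma s9_ceil (N : ℕ) : ((N * N - N * N / 4 : ℕ) : ℤ) = ⌈(3 * (N : ℚ) ^ 2) / 4⌉ := by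
  symm
  rw [Int.ceil_eq_iff]
  generalize hM : N * N - N * N / 4 = M
  have h1 : 3 * (N * N) ≤ 4 * M := by omega
  have h2 : 4 * M < 3 * (N * N) + 4 := by omega
  have h1' : (3 : ℚ) * (N * N) ≤ 4 * M := by exact_mod_cast h1
  have h2' : (4 : ℚ) * M < 3 * (N * N) + 4 := by exact_mod_cast h2
  push_cast
  constructor <;> nlinarith

lemma s9_D (N : ℕ) : Dcolength ℚ 2 ![N, N, N] = Module.finrank ℚ (MvPolynomial (Fin 2) ℚ ⧸ s9I N) := by
  unfold Dcolength s9I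
  have : (Set.range (fun i : Fin 2 =>
        (X i : MvPolynomial (Fin 2) ℚ) ^ (![N, N, N] : Fin 3 → ℕ) i.castSucc) ∪
      {(∑ i : Fin 2, (X i : MvPolynomial (Fin 2) ℚ)) ^ (![N, N, N] : Fin 3 → ℕ) (Fin.last 2)})
      = {X 0 ^ N, X 1 ^ N, (X 0 + X 1) ^ N} := by
    ext p
    simp [Fin.exists_fin_two, Fin.sum_univ_two, or_assoc, eq_comm, Fin.last]
    tauto
  rw [this]

/-- the three-variable ideal -/
noncomputable def s9J (N : ℕ) : Ideal (MvPolynomial (Fin 3) ℚ) :=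
  Ideal.span {(X 0 + X 1 + X 2 : MvPolynomial (Fin 3) ℚ), X 0 ^ N, X 1 ^ N, X 2 ^ N}

lemma s9_three (N : ℕ) : Module.finrank ℚ (MvPolynomial (Fin 3) ℚ ⧸ s9J N)
    = Module.finrank ℚ (MvPolynomial (Fin 2) ℚ ⧸ s9I N) := by
  let φ0 : MvPolynomial (Fin 3) ℚ →ₐ[ℚ] MvPolynomial (Fin 2) ℚ :=
    aeval ![X 0, X 1, -(X 0 + X 1)]
  let ψ0 : MvPolynomial (Fin 2) ℚ →ₐ[ℚ] MvPolynomial (Fin 3) ℚ := aeval ![X 0, X 1]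
  have hφ : s9J N ≤ (s9I N).comap φ0 := by
    rw [s9J, Ideal.span_le]
    rintro p (rfl | rfl | rfl | rfl)
    · simp [φ0]
    · simpa [φ0] using s9I_x N
    · simpa [φ0] using s9I_y N
    · have : (-(X 0 + X 1) : MvPolynomial (Fin 2) ℚ) ^ N ∈ s9I N := by
        rw [neg_pow]; exact Ideal.mul_mem_left _ _ (s9I_s N)
      simpa [φ0] using this
  have j0 : (X 0 + X 1 + X 2 : MvPolynomial (Fin 3) ℚ) ∈ s9J N := Ideal.subset_span (by simp)
  have j1 : (X 0 ^ N : MvPolynomial (Fin 3) ℚ) ∈ s9J N := Ideal.subset_span (by simp)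
  have j2 : (X 1 ^ N : MvPolynomial (Fin 3) ℚ) ∈ s9J N := Ideal.subset_span (by simp)
  have j3 : (X 2 ^ N : MvPolynomial (Fin 3) ℚ) ∈ s9J N := Ideal.subset_span (by simp)
  have hq : Ideal.Quotient.mk (s9J N) (X 0 + X 1) = Ideal.Quotient.mk (s9J N) (-X 2) := by
    rw [Ideal.Quotient.eq]
    simpa using j0
  have hψ : s9I N ≤ (s9J N).comap ψ0 := by
    rw [s9I, Ideal.span_le]
    rintro p (rfl | rfl | rfl)
    · simpa [ψ0] using j1
    · simpa [ψ0] using j2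
    · have : ((X 0 + X 1) ^ N : MvPolynomial (Fin 3) ℚ) ∈ s9J N := by
        rw [← Ideal.Quotient.eq_zero_iff_mem, map_pow, hq, ← map_pow,
          Ideal.Quotient.eq_zero_iff_mem, neg_pow]
        exact Ideal.mul_mem_left _ _ j3
      simpa [ψ0] using this
  let φ : (MvPolynomial (Fin 3) ℚ ⧸ s9J N) →ₐ[ℚ] (MvPolynomial (Fin 2) ℚ ⧸ s9I N) :=
    Ideal.quotientMapₐ _ φ0 hφ
  let ψ : (MvPolynomial (Fin 2) ℚ ⧸ s9I N) →ₐ[ℚ] (MvPolynomial (Fin 3) ℚ ⧸ s9J N) :=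
    Ideal.quotientMapₐ _ ψ0 hψ
  have c1 : φ.comp ψ = AlgHom.id ℚ _ := by
    apply Ideal.Quotient.algHom_ext
    apply MvPolynomial.algHom_ext
    intro i
    fin_cases i <;> simp [φ, ψ, φ0, ψ0]
  have c2 : ψ.comp φ = AlgHom.id ℚ _ := by
    apply Ideal.Quotient.algHom_ext
    apply MvPolynomial.algHom_ext
    intro i
    rw [map_add] at hq
    fin_cases i <;> simp [φ, ψ, φ0, ψ0]
    rw [← neg_add, add_comm, hq]; simp
  exact LinearEquiv.finrank_eq (AlgEquiv.ofAlgHom φ ψ c1 c2).toLinearEquiv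

lemma s9_limit : Filter.Tendsto (fun N : ℕ => ((N * N - N * N / 4 : ℕ) : ℝ) / (N : ℝ) ^ 2)
    Filter.atTop (nhds (3 / 4)) := by
  have hz : Filter.Tendsto (fun N : ℕ => (3 / 4 : ℝ) + 1 / (N : ℝ)) Filter.atTop
      (nhds (3 / 4)) := by
    simpa using tendsto_one_div_atTop_nhds_zero_nat.const_add (3 / 4 : ℝ)
  refine tendsto_of_tendsto_of_tendsto_of_le_of_le' tendsto_const_nhds hz ?_ ?_
  all_goals
    filter_upwards [Filter.eventually_ge_atTop 1] with N hN
    generalize hM : N * N - N * N / 4 = M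
    have h1 : 3 * (N * N) ≤ 4 * M := by omega
    have h2 : 4 * M < 3 * (N * N) + 4 := by omega
    have h1' : (3 : ℝ) * (N * N) ≤ 4 * M := by exact_mod_cast h1
    have h2' : (4 : ℝ) * M < 3 * (N * N) + 4 := by exact_mod_cast h2
    have hN' : (1 : ℝ) ≤ N := by exact_mod_cast hN
    have hp : (0 : ℝ) < (N : ℝ) ^ 2 := by positivity
  · rw [le_div_iff₀ hp]; nlinarith
  · rw [div_le_iff₀ hp]
    have : (3 / 4 + 1 / (N : ℝ)) * (N : ℝ) ^ 2 = 3 / 4 * (N * N) + N := by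
      field_simp
    rw [this]; linarith


/-- For every `N ≥ 1`,
`dim_ℚ ℚ[x₁,x₂,x₃]/(x₁+x₂+x₃, x₁^N, x₂^N, x₃^N) = ⌈3N²/4⌉`; equivalently
`dim_ℚ ℚ[x,y]/(x^N, y^N, (x+y)^N) = ⌈3N²/4⌉`. Consequently the naive limit
`lim_{N→∞} dim_ℚ (R_ℚ/(x₁^N, x₂^N, x₃^N))/N²` for
`R_ℚ = ℚ[x₁,x₂,x₃]/(x₁+x₂+x₃)` equals `3/4`. -/
theorem statement9 :
    (∀ N : ℕ, 1 ≤ N →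
      ((Module.finrank ℚ (MvPolynomial (Fin 3) ℚ ⧸
          Ideal.span {(X 0 + X 1 + X 2 : MvPolynomial (Fin 3) ℚ),
            X 0 ^ N, X 1 ^ N, X 2 ^ N}) : ℤ) = ⌈(3 * (N : ℚ) ^ 2) / 4⌉ ∧
        (Dcolength ℚ 2 ![N, N, N] : ℤ) = ⌈(3 * (N : ℚ) ^ 2) / 4⌉)) ∧
    Filter.Tendsto
      (fun N : ℕ =>
        (Module.finrank ℚ (MvPolynomial (Fin 3) ℚ ⧸
          Ideal.span {(X 0 + X 1 + X 2 : MvPolynomial (Fin 3) ℚ),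
            X 0 ^ N, X 1 ^ N, X 2 ^ N}) : ℝ) / (N : ℝ) ^ 2)
      Filter.atTop (nhds (3 / 4)) := by
  have hfin : ∀ N : ℕ, 1 ≤ N → Module.finrank ℚ (MvPolynomial (Fin 3) ℚ ⧸
          Ideal.span {(X 0 + X 1 + X 2 : MvPolynomial (Fin 3) ℚ),
            X 0 ^ N, X 1 ^ N, X 2 ^ N}) = N * N - N * N / 4 := fun N hN =>
    (s9_three N).trans (s9_finrank N hN)
  refine ⟨fun N hN => ⟨?_, ?_⟩, ?_⟩
  · rw [hfin N hN]; exact s9_ceil N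
  · rw [s9_D, s9_finrank N hN]; exact s9_ceil N
  · refine s9_limit.congr' ?_
    filter_upwards [Filter.eventually_ge_atTop 1] with N hN
    rw [hfin N hN]
end

section
/- Let p be an odd prime, set F = ℤ/pℤ, R = F[x, y, z]/(x^4 + y^4 + z^4), and I = (x, y, z). Then the Hilbert–Kunz multiplicity e_HK(I, R) = lim_{n→∞} dim_F(R/I^{[p^n]})/p^{2n} exists and equals 3 + 1/p² if p ≡ 3 or 5 (mod 8), and equals 3 if p ≡ 1 or 7 (mod 8). In particular e_HK(I, R) = 3 + O(1/p²) as p → ∞. -/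
open MvPolynomial Filter

namespace HK
open scoped Polynomial

/-- The linear form `-(1+t)`. -/
noncomputable def ww (F : Type) [CommRing F] : F[X] := -(Polynomial.X - Polynomial.C (-1))

/-- Dehomogenised syzygies of degree `d` of `(x^m, y^m, z^m)`, `z = -(x+y)`. -/
def Syz (F : Type) [CommRing F] (m d : ℕ) (A B C : F[X]) : Prop :=
  A.degree < ((d + 1 - m : ℕ) : WithBot ℕ) ∧ B.degree < ((d + 1 - m : ℕ) : WithBot ℕ) ∧
  C.degree < ((d + 1 - m : ℕ) : WithBot ℕ) ∧
  Polynomial.X ^ m * A + B + ww F ^ m * C = 0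

/-- Existence of a nonzero syzygy of degree `d`. -/
def HasSyz (F : Type) [CommRing F] (m d : ℕ) : Prop :=
  ∃ A B C : F[X], Syz F m d A B C ∧ ¬ (A = 0 ∧ B = 0 ∧ C = 0)

theorem descent (p : ℕ) [Fact p.Prime] : ∀ (N : ℕ) (f g e : (ZMod p)[X]),
    f.natDegree + g.natDegree + e.natDegree = N → f ≠ 0 → g ≠ 0 → e ≠ 0 → IsCoprime f g →
    f + g + e = 0 → 0 < N →
    ∃ (s : ℕ) (f1 g1 e1 : (ZMod p)[X]), f = f1 ^ (p ^ s) ∧ g = g1 ^ (p ^ s) ∧ e = e1 ^ (p ^ s) ∧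
      f1 ≠ 0 ∧ g1 ≠ 0 ∧ e1 ≠ 0 ∧
      f1.natDegree + 1 ≤ (UniqueFactorizationMonoid.radical (f1 * g1 * e1)).natDegree ∧
      g1.natDegree + 1 ≤ (UniqueFactorizationMonoid.radical (f1 * g1 * e1)).natDegree ∧
      e1.natDegree + 1 ≤ (UniqueFactorizationMonoid.radical (f1 * g1 * e1)).natDegree := by
  intro N
  induction N using Nat.strong_induction_on with
  | _ N ih =>
    intro f g e hN hf hg he hc hs hpos
    rcases Polynomial.abc hf hg he hc hs with ⟨h1, h2, h3⟩ | ⟨h1, h2, h3⟩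
    · exact ⟨0, f, g, e, by simp, by simp, by simp, hf, hg, he, h1, h2, h3⟩
    · have hp := (Fact.out : p.Prime)
      have key : ∀ f : (ZMod p)[X], Polynomial.derivative f = 0 → ∃ f1, f = f1 ^ p := by
        intro f h
        refine ⟨Polynomial.contract p f, ?_⟩
        rw [← ZMod.expand_card, Polynomial.expand_contract p h hp.ne_zero]
      obtain ⟨f1, rfl⟩ := key f h1
      obtain ⟨g1, rfl⟩ := key g h2
      obtain ⟨e1, rfl⟩ := key e h3
      have hp0 := hp.pos
      have hsum : f1 + g1 + e1 = 0 := by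
        have : (f1 + g1 + e1) ^ p = 0 := by
          rw [add_pow_char, add_pow_char]; exact hs
        exact pow_eq_zero_iff hp.ne_zero |>.1 this
      have hc1 : IsCoprime f1 g1 := by
        rwa [IsCoprime.pow_iff hp0 hp0] at hc
      simp only [Polynomial.natDegree_pow] at hN
      have hN' : p * (f1.natDegree + g1.natDegree + e1.natDegree) = N := by rw [← hN]; ring
      have hpos' : 0 < f1.natDegree + g1.natDegree + e1.natDegree := by
        rcases Nat.eq_zero_or_pos (f1.natDegree + g1.natDegree + e1.natDegree) with h | h
        · rw [h] at hN'; omega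
        · exact h
      have hlt : f1.natDegree + g1.natDegree + e1.natDegree < N := by
        have := hp.two_le
        nlinarith
      obtain ⟨s, f2, g2, e2, a1, a2, a3, a4⟩ := ih _ hlt f1 g1 e1 rfl
        (fun h => hf (by rw [h, zero_pow hp.ne_zero]))
        (fun h => hg (by rw [h, zero_pow hp.ne_zero]))
        (fun h => he (by rw [h, zero_pow hp.ne_zero])) hc1 hsum hpos'
      exact ⟨s + 1, f2, g2, e2, by rw [a1, ← pow_mul, pow_succ], by rw [a2, ← pow_mul, pow_succ],
        by rw [a3, ← pow_mul, pow_succ], a4⟩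

theorem rootMult_le {F : Type} [Field F] (f : F[X]) (hf : f ≠ 0) (a : F) :
    f.rootMultiplicity a ≤ f.natDegree := by
  have := Polynomial.natDegree_le_of_dvd (Polynomial.pow_rootMultiplicity_dvd f a) hf
  simpa only [Polynomial.natDegree_pow, Polynomial.natDegree_X_sub_C, mul_one] using this

theorem rootMult_pow {F : Type} [Field F] (f : F[X]) (hf : f ≠ 0) (a : F) (n : ℕ) :
    (f ^ n).rootMultiplicity a = n * f.rootMultiplicity a := by
  induction n with
  | zero => rw [pow_zero, zero_mul, ← Polynomial.C_1, Polynomial.rootMultiplicity_C]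
  | succ n ih =>
    rw [pow_succ, Polynomial.rootMultiplicity_mul (mul_ne_zero (pow_ne_zero _ hf) hf), ih]
    ring

theorem rad_bound {F : Type} [Field F] [DecidableEq F] (f g e : F[X]) (hf : f ≠ 0) (hg : g ≠ 0) (he : e ≠ 0)
    (a b : F) :
    (UniqueFactorizationMonoid.radical (f * g * e)).natDegree + f.rootMultiplicity a
      + e.rootMultiplicity b ≤ f.natDegree + g.natDegree + e.natDegree + 2 := by
  obtain ⟨f2, hf2⟩ := Polynomial.pow_rootMultiplicity_dvd f a
  obtain ⟨e2, he2⟩ := Polynomial.pow_rootMultiplicity_dvd e b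
  set α := f.rootMultiplicity a
  set γ := e.rootMultiplicity b
  have hf20 : f2 ≠ 0 := by rintro rfl; simp at hf2; exact hf hf2
  have he20 : e2 ≠ 0 := by rintro rfl; simp at he2; exact he he2
  have hX : ∀ c : F, (Polynomial.X - Polynomial.C c) ≠ 0 := Polynomial.X_sub_C_ne_zero
  have hdvd : UniqueFactorizationMonoid.radical (f * g * e) ∣
      (Polynomial.X - Polynomial.C a) * f2 * g * ((Polynomial.X - Polynomial.C b) * e2) := by
    rw [← UniqueFactorizationMonoid.exists_dvd_pow_iff_radical_dvd
      (mul_ne_zero (mul_ne_zero hf hg) he)]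
    refine ⟨α + γ + 1, ?_⟩
    have h1 : f ∣ ((Polynomial.X - Polynomial.C a) * f2) ^ (α + γ + 1) := by
      conv_lhs => rw [hf2]
      rw [mul_pow]
      exact mul_dvd_mul (pow_dvd_pow _ (by omega)) (dvd_pow_self _ (by omega))
    have h2 : e ∣ ((Polynomial.X - Polynomial.C b) * e2) ^ (α + γ + 1) := by
      conv_lhs => rw [he2]
      rw [mul_pow]
      exact mul_dvd_mul (pow_dvd_pow _ (by omega)) (dvd_pow_self _ (by omega))
    rw [mul_pow, mul_pow]
    exact mul_dvd_mul (mul_dvd_mul h1 (dvd_pow_self _ (by omega))) h2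
  have hle := Polynomial.natDegree_le_of_dvd hdvd (by simp [hX, hf20, he20, hg])
  rw [Polynomial.natDegree_mul (by simp [hX, hf20, hg]) (by simp [hX, he20]),
    Polynomial.natDegree_mul (by simp [hX, hf20]) hg,
    Polynomial.natDegree_mul (hX _) hf20, Polynomial.natDegree_mul (hX _) he20] at hle
  simp only [Polynomial.natDegree_X_sub_C] at hle
  have hdf : f.natDegree = α + f2.natDegree := by
    rw [hf2, Polynomial.natDegree_mul (pow_ne_zero _ (hX _)) hf20]; simp
  have hde : e.natDegree = γ + e2.natDegree := by
    rw [he2, Polynomial.natDegree_mul (pow_ne_zero _ (hX _)) he20]; simp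
  omega

theorem Syz.nonzero {F : Type} [Field F] {m d : ℕ} {A B C : F[X]} (h : Syz F m d A B C)
    (hd : d < 2 * m) (hne : ¬ (A = 0 ∧ B = 0 ∧ C = 0)) : A ≠ 0 ∧ B ≠ 0 ∧ C ≠ 0 := by
  obtain ⟨hA, hB, hC, hsum⟩ := h
  have hw : ww F ≠ 0 := by
    rw [ww, neg_ne_zero]; exact Polynomial.X_sub_C_ne_zero _
  have hww : (ww F).natDegree = 1 := by
    rw [ww, Polynomial.natDegree_neg, Polynomial.natDegree_X_sub_C]
  have hdeg : ∀ P : F[X], P.degree < ((d + 1 - m : ℕ) : WithBot ℕ) → P ≠ 0 → P.natDegree < m := by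
    intro P hP h0
    have := (Polynomial.natDegree_lt_iff_degree_lt h0).2 hP
    omega
  have hcop : IsCoprime ((Polynomial.X : F[X]) ^ m) (ww F ^ m) := by
    apply IsCoprime.pow
    exact ⟨-1, -1, by rw [ww]; simp⟩
  have hX : ∀ P : F[X], P.degree < ((d + 1 - m : ℕ) : WithBot ℕ) → Polynomial.X ^ m ∣ P → P = 0 := by
    intro P hP hdv
    by_contra h0
    have := Polynomial.natDegree_le_of_dvd hdv h0
    have := hdeg P hP h0
    simp at *
    omega
  have hW : ∀ P : F[X], P.degree < ((d + 1 - m : ℕ) : WithBot ℕ) → ww F ^ m ∣ P → P = 0 := by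
    intro P hP hdv
    by_contra h0
    have := Polynomial.natDegree_le_of_dvd hdv h0
    have := hdeg P hP h0
    simp [hww] at *
    omega
  have hXn : (Polynomial.X : F[X]) ^ m ≠ 0 := pow_ne_zero _ Polynomial.X_ne_zero
  have hwn : ww F ^ m ≠ 0 := pow_ne_zero _ hw
  refine ⟨?_, ?_, ?_⟩
  · rintro rfl
    have hB0 : B = 0 := hW B hB ⟨-C, by linear_combination hsum⟩
    subst hB0
    have : ww F ^ m * C = 0 := by simpa using hsum
    exact hne ⟨rfl, rfl, (mul_eq_zero.1 this).resolve_left hwn⟩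
  · rintro rfl
    have hC0 : C = 0 := hX C hC (hcop.dvd_of_dvd_mul_left ⟨-A, by linear_combination hsum⟩)
    subst hC0
    have : (Polynomial.X : F[X]) ^ m * A = 0 := by simpa using hsum
    exact hne ⟨(mul_eq_zero.1 this).resolve_left hXn, rfl, rfl⟩
  · rintro rfl
    have hB0 : B = 0 := hX B hB ⟨-A, by linear_combination hsum⟩
    subst hB0
    have : (Polynomial.X : F[X]) ^ m * A = 0 := by simpa using hsum
    exact hne ⟨(mul_eq_zero.1 this).resolve_left hXn, rfl, rfl⟩

theorem han (p : ℕ) [Fact p.Prime] {m d : ℕ} (h : HasSyz (ZMod p) m d) (hd : 2 * d < 3 * m) :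
    ∃ s i j k κ α β γ : ℕ, m ≤ p ^ s * α + i ∧ m ≤ p ^ s * β + j ∧ m ≤ p ^ s * γ + k ∧
      p ^ s * κ + i + j + k ≤ d ∧ α + β + γ ≤ 2 * κ + 1 := by
  obtain ⟨A, B, C, hS, hne⟩ := h
  obtain ⟨hA0, hB0, hC0⟩ := hS.nonzero (by omega) hne
  obtain ⟨hA, hB, hC, hsum⟩ := hS
  have hAd := (Polynomial.natDegree_lt_iff_degree_lt hA0).2 hA
  have hBd := (Polynomial.natDegree_lt_iff_degree_lt hB0).2 hB
  have hCd := (Polynomial.natDegree_lt_iff_degree_lt hC0).2 hC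
  set F := ZMod p
  have hw : ww F ≠ 0 := by
    rw [ww, neg_ne_zero]; exact Polynomial.X_sub_C_ne_zero _
  have hww : (ww F).natDegree = 1 := by
    rw [ww, Polynomial.natDegree_neg, Polynomial.natDegree_X_sub_C]
  set f : F[X] := Polynomial.X ^ m * A with hf
  set e : F[X] := ww F ^ m * C with he
  have hf0 : f ≠ 0 := mul_ne_zero (pow_ne_zero _ Polynomial.X_ne_zero) hA0
  have he0 : e ≠ 0 := mul_ne_zero (pow_ne_zero _ hw) hC0
  have hfd : f.natDegree ≤ d := by
    rw [hf, Polynomial.natDegree_mul (pow_ne_zero _ Polynomial.X_ne_zero) hA0]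
    simp; omega
  have hed : e.natDegree ≤ d := by
    rw [he, Polynomial.natDegree_mul (pow_ne_zero _ hw) hC0]
    simp [hww]; omega
  -- common factor
  set G := EuclideanDomain.gcd f B with hG
  have hG0 : G ≠ 0 := by
    intro h; rw [hG, EuclideanDomain.gcd_eq_zero_iff] at h; exact hf0 h.1
  obtain ⟨f', hf'⟩ : G ∣ f := EuclideanDomain.gcd_dvd_left _ _
  obtain ⟨g', hg'⟩ : G ∣ B := EuclideanDomain.gcd_dvd_right _ _
  have hcop : IsCoprime f' g' := by
    have := EuclideanDomain.gcd_eq_gcd_ab f B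
    refine ⟨EuclideanDomain.gcdA f B, EuclideanDomain.gcdB f B, ?_⟩
    apply mul_left_cancel₀ hG0
    rw [mul_one]
    conv_rhs => rw [hG, this]
    conv_rhs => rw [hf', hg']
    rw [← hf', ← hg']
    linear_combination (-EuclideanDomain.gcdA f B) * hf' - EuclideanDomain.gcdB f B * hg'
  set e' := -(f' + g') with he'
  have hee : e = G * e' := by
    rw [he']; linear_combination hsum - hf' - hg'
  have hf'0 : f' ≠ 0 := by rintro h; rw [h, mul_zero] at hf'; exact hf0 hf'
  have hg'0 : g' ≠ 0 := by rintro h; rw [h, mul_zero] at hg'; exact hB0 hg'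
  have he'0 : e' ≠ 0 := by rintro h; rw [h, mul_zero] at hee; exact he0 hee
  have hdf : f.natDegree = G.natDegree + f'.natDegree := by
    rw [hf', Polynomial.natDegree_mul hG0 hf'0]
  have hdg : B.natDegree = G.natDegree + g'.natDegree := by
    rw [hg', Polynomial.natDegree_mul hG0 hg'0]
  have hde : e.natDegree = G.natDegree + e'.natDegree := by
    rw [hee, Polynomial.natDegree_mul hG0 he'0]
  have hof : m ≤ G.rootMultiplicity 0 + f'.rootMultiplicity 0 := by
    rw [← Polynomial.rootMultiplicity_mul (by rw [← hf']; exact hf0), ← hf',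
      Polynomial.le_rootMultiplicity_iff hf0]
    exact ⟨A, by rw [hf]; simp⟩
  have hoe : m ≤ G.rootMultiplicity (-1) + e'.rootMultiplicity (-1) := by
    rw [← Polynomial.rootMultiplicity_mul (by rw [← hee]; exact he0), ← hee,
      Polynomial.le_rootMultiplicity_iff he0]
    exact ⟨(-1) ^ m * C, by rw [he, ww, neg_pow]; ring⟩
  have hoG : G.rootMultiplicity 0 + G.rootMultiplicity (-1) ≤ G.natDegree := by
    have h1 := Polynomial.pow_rootMultiplicity_dvd G 0
    have h2 := Polynomial.pow_rootMultiplicity_dvd G (-1)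
    have hc : IsCoprime ((Polynomial.X - Polynomial.C (0:F)) ^ G.rootMultiplicity 0)
        ((Polynomial.X - Polynomial.C (-1:F)) ^ G.rootMultiplicity (-1)) := by
      apply IsCoprime.pow
      exact Polynomial.isCoprime_X_sub_C_of_isUnit_sub (by simp)
    have := Polynomial.natDegree_le_of_dvd (hc.mul_dvd h1 h2) hG0
    rw [Polynomial.natDegree_mul (pow_ne_zero _ (Polynomial.X_sub_C_ne_zero _))
      (pow_ne_zero _ (Polynomial.X_sub_C_ne_zero _))] at this
    simpa only [Polynomial.natDegree_pow, Polynomial.natDegree_X_sub_C, mul_one] using this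
  have hpos : 0 < f'.natDegree + g'.natDegree + e'.natDegree := by
    by_contra hcon
    have h1 : f'.rootMultiplicity 0 ≤ f'.natDegree :=
      rootMult_le _ hf'0 _
    have h2 : e'.rootMultiplicity (-1) ≤ e'.natDegree :=
      rootMult_le _ he'0 _
    omega
  obtain ⟨s, f1, g1, e1, r1, r2, r3, z1, z2, z3, b1, b2, b3⟩ :=
    descent p _ f' g' e' rfl hf'0 hg'0 he'0 hcop (by rw [he']; ring) hpos
  have hrad := rad_bound f1 g1 e1 z1 z2 z3 0 (-1)
  have m1 : f'.rootMultiplicity 0 = p ^ s * f1.rootMultiplicity 0 := by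
    rw [r1, rootMult_pow _ z1]
  have m3 : e'.rootMultiplicity (-1) = p ^ s * e1.rootMultiplicity (-1) := by
    rw [r3, rootMult_pow _ z3]
  have n1 : f'.natDegree = p ^ s * f1.natDegree := by rw [r1, Polynomial.natDegree_pow]
  have n2 : g'.natDegree = p ^ s * g1.natDegree := by rw [r2, Polynomial.natDegree_pow]
  have n3 : e'.natDegree = p ^ s * e1.natDegree := by rw [r3, Polynomial.natDegree_pow]
  obtain ⟨κ, k1, k2, k3, k4⟩ : ∃ κ, f1.natDegree ≤ κ ∧ g1.natDegree ≤ κ ∧ e1.natDegree ≤ κ ∧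
      (κ = f1.natDegree ∨ κ = g1.natDegree ∨ κ = e1.natDegree) :=
    ⟨max f1.natDegree (max g1.natDegree e1.natDegree), by omega, by omega, by omega, by omega⟩
  have hκ : p ^ s * κ + G.natDegree ≤ d := by
    rcases k4 with h | h | h <;> rw [h] <;> omega
  obtain ⟨β, hβ⟩ := Nat.exists_eq_add_of_le k2
  have hβ' : p ^ s * κ = p ^ s * g1.natDegree + p ^ s * β := by rw [hβ]; ring
  refine ⟨s, G.rootMultiplicity 0, d - (p ^ s * κ + G.natDegree), G.rootMultiplicity (-1), κ,
    f1.rootMultiplicity 0, β, e1.rootMultiplicity (-1), ?_, ?_, ?_, ?_, ?_⟩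
  · omega
  · omega
  · omega
  · omega
  · omega

theorem gap_core (p : ℕ) [Fact p.Prime] {m d : ℕ} (h : HasSyz (ZMod p) m d)
    (hd : 2 * d < 3 * m) : ∃ s α β γ : ℕ, (α + β + γ) % 2 = 1 ∧
      (3 * m - 2 * d : ℤ) + |(m : ℤ) - p ^ s * α| + |(m : ℤ) - p ^ s * β| + |(m : ℤ) - p ^ s * γ|
        ≤ (p : ℤ) ^ s := by
  obtain ⟨s, i, j, k, κ, α, β, γ, h1, h2, h3, h4, h5⟩ := han p h hd
  refine ⟨s, α, β, γ, ?_, ?_⟩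
  · by_contra hodd
    have : α + β + γ ≤ 2 * κ := by omega
    have := Nat.mul_le_mul_left (p ^ s) this
    simp only [mul_add, Nat.mul_left_comm _ 2] at this
    omega
  · have := Nat.mul_le_mul_left (p ^ s) h5
    simp only [mul_add, Nat.mul_left_comm _ 2, mul_one] at this
    zify at *
    rcases abs_cases ((m : ℤ) - p ^ s * α) with ⟨e1, _⟩ | ⟨e1, _⟩ <;>
    rcases abs_cases ((m : ℤ) - p ^ s * β) with ⟨e2, _⟩ | ⟨e2, _⟩ <;>
    rcases abs_cases ((m : ℤ) - p ^ s * γ) with ⟨e3, _⟩ | ⟨e3, _⟩ <;>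
    rw [e1, e2, e3] <;> linarith

theorem term_bound (Q r m α : ℤ) (hQ : 0 ≤ Q) (h : |4 * m - Q * r| ≤ 4) :
    Q * |r - 4 * α| - 4 ≤ 4 * |m - Q * α| := by
  have e : Q * (r - 4 * α) = 4 * (m - Q * α) - (4 * m - Q * r) := by ring
  have : Q * |r - 4 * α| = |Q * (r - 4 * α)| := by rw [abs_mul, abs_of_nonneg hQ]
  rw [this, e]
  have := abs_sub (4 * (m - Q * α)) (4 * m - Q * r)
  rw [abs_mul] at this
  norm_num at this
  linarith

theorem odd_bound1 (r α β γ : ℤ) (hr : r % 8 = 1 ∨ r % 8 = 7) (h : (α + β + γ) % 2 = 1) :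
    5 ≤ |r - 4 * α| + |r - 4 * β| + |r - 4 * γ| := by
  rcases abs_cases (r - 4 * α) with ⟨e1, _⟩ | ⟨e1, _⟩ <;>
  rcases abs_cases (r - 4 * β) with ⟨e2, _⟩ | ⟨e2, _⟩ <;>
  rcases abs_cases (r - 4 * γ) with ⟨e3, _⟩ | ⟨e3, _⟩ <;>
  rw [e1, e2, e3] <;> omega

theorem odd_bound2 (r α β γ : ℤ) (hr : r % 2 = 1) :
    3 ≤ |r - 4 * α| + |r - 4 * β| + |r - 4 * γ| := by
  rcases abs_cases (r - 4 * α) with ⟨e1, _⟩ | ⟨e1, _⟩ <;>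
  rcases abs_cases (r - 4 * β) with ⟨e2, _⟩ | ⟨e2, _⟩ <;>
  rcases abs_cases (r - 4 * γ) with ⟨e3, _⟩ | ⟨e3, _⟩ <;>
  rw [e1, e2, e3] <;> omega

theorem far_bound1 (Q m α : ℤ) (hm : 0 ≤ m) (hQ : 2 * m ≤ Q) : m ≤ |m - Q * α| := by
  rcases le_or_gt α 0 with h | h
  · have : Q * α ≤ 0 := mul_nonpos_of_nonneg_of_nonpos (by linarith) h
    rw [abs_of_nonneg] <;> linarith
  · have : Q * 1 ≤ Q * α := mul_le_mul_of_nonneg_left (by linarith) (by linarith)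
    rw [abs_of_nonpos] <;> linarith

theorem far_bound2 (Q m α : ℤ) (hm : 0 ≤ m) (hQ : 2 * m ≤ Q) (h : 1 ≤ α) :
    Q - m ≤ |m - Q * α| := by
  have : Q * 1 ≤ Q * α := mul_le_mul_of_nonneg_left (by linarith) (by linarith)
  rw [abs_of_nonpos] <;> linarith

theorem pow_mod8 (p : ℕ) (hp : p % 8 = 1 ∨ p % 8 = 7) (n : ℕ) :
    p ^ n % 8 = 1 ∨ p ^ n % 8 = 7 := by
  induction n with
  | zero => simp
  | succ n ih =>
    rw [pow_succ, Nat.mul_mod]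
    rcases ih with h | h <;> rcases hp with h' | h' <;> simp [h, h']

theorem upper_gap (p : ℕ) [Fact p.Prime] (hp : 3 ≤ p) (hodd : p % 2 = 1) {m d n : ℕ}
    (hm : 1 ≤ m) (h : HasSyz (ZMod p) m d) (hq : |4 * (m : ℤ) - (p : ℤ) ^ (n + 1)| ≤ 4) :
    4 * (3 * m - 2 * d : ℤ) ≤ (p : ℤ) ^ n + 12 ∧
    ((p % 8 = 1 ∨ p % 8 = 7) → 4 * (3 * m - 2 * d : ℤ) ≤ 12) := by
  have hp0 : (0 : ℤ) < (p : ℤ) ^ n := by positivity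
  rcases Nat.lt_or_ge (2 * d) (3 * m) with hd | hd
  swap
  · constructor
    · zify at hd; linarith
    · intro _; zify at hd; linarith
  obtain ⟨s, α, β, γ, h1, h2⟩ := gap_core p h hd
  have hQ : (0 : ℤ) < (p : ℤ) ^ s := by positivity
  rcases Nat.lt_or_ge (n + 1) s with hs | hs
  · -- far case: contradiction
    exfalso
    have hpow : (p : ℤ) ^ (n + 1) * 3 ≤ (p : ℤ) ^ s := by
      calc (p : ℤ) ^ (n + 1) * 3 ≤ (p : ℤ) ^ (n + 1) * p := by
            gcongr; exact_mod_cast hp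
        _ = (p : ℤ) ^ (n + 2) := by ring
        _ ≤ (p : ℤ) ^ s := by
            apply pow_le_pow_right₀ (by exact_mod_cast (by omega : 1 ≤ p)) (by omega)
    have hq1 : (1 : ℤ) ≤ (p : ℤ) ^ (n + 1) := by
      have : (0 : ℤ) < (p : ℤ) ^ (n + 1) := by positivity
      linarith
    have hq2 := (abs_le.1 hq).2
    have hm0 : (1 : ℤ) ≤ m := by exact_mod_cast hm
    have hQm : 2 * (m : ℤ) ≤ (p : ℤ) ^ s := by linarith
    have f1 := far_bound1 _ (m : ℤ) α (by linarith) hQm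
    have f2 := far_bound1 _ (m : ℤ) β (by linarith) hQm
    have f3 := far_bound1 _ (m : ℤ) γ (by linarith) hQm
    zify at hd
    rcases (by omega : 1 ≤ α ∨ 1 ≤ β ∨ 1 ≤ γ) with h | h | h
    · have := far_bound2 _ (m : ℤ) α (by linarith) hQm (by exact_mod_cast h)
      linarith
    · have := far_bound2 _ (m : ℤ) β (by linarith) hQm (by exact_mod_cast h)
      linarith
    · have := far_bound2 _ (m : ℤ) γ (by linarith) hQm (by exact_mod_cast h)
      linarith
  · obtain ⟨t, ht⟩ := Nat.exists_eq_add_of_le hs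
    have hqr : (p : ℤ) ^ (n + 1) = (p : ℤ) ^ s * (p : ℤ) ^ t := by rw [ht, pow_add]
    rw [hqr] at hq
    have t1 := term_bound _ _ _ (α : ℤ) hQ.le hq
    have t2 := term_bound _ _ _ (β : ℤ) hQ.le hq
    have t3 := term_bound _ _ _ (γ : ℤ) hQ.le hq
    have five : ∀ c : ℤ, c ≤ |(p : ℤ) ^ t - 4 * α| + |(p : ℤ) ^ t - 4 * β| + |(p : ℤ) ^ t - 4 * γ| →
        4 * (3 * m - 2 * d : ℤ) ≤ (4 - c) * (p : ℤ) ^ s + 12 := by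
      intro c hc
      have := mul_le_mul_of_nonneg_left hc hQ.le
      linarith
    have hodd' : ((α : ℤ) + β + γ) % 2 = 1 := by exact_mod_cast h1
    have hfive : ((p : ℤ) ^ t % 8 = 1 ∨ (p : ℤ) ^ t % 8 = 7) →
        4 * (3 * m - 2 * d : ℤ) ≤ 12 := by
      intro hr
      have := five 5 (odd_bound1 _ _ _ _ hr hodd')
      linarith
    constructor
    · rcases Nat.eq_zero_or_pos t with h0 | h0
      · have := hfive (by subst h0; simp)
        linarith
      · have hr : (p : ℤ) ^ t % 2 = 1 := by
          have : p ^ t % 2 = 1 := by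
            rw [Nat.pow_mod, hodd]; simp
          exact_mod_cast this
        have := five 3 (odd_bound2 _ _ _ _ hr)
        have : (p : ℤ) ^ s ≤ (p : ℤ) ^ n :=
          pow_le_pow_right₀ (by exact_mod_cast (by omega : 1 ≤ p)) (by omega)
        linarith
    · intro h8
      apply hfive
      exact_mod_cast pow_mod8 p h8 t

theorem natDegree_ww {F : Type} [Field F] : (ww F).natDegree = 1 := by
  rw [ww, Polynomial.natDegree_neg, Polynomial.natDegree_X_sub_C]

theorem ww_ne {F : Type} [Field F] : ww F ≠ 0 := by
  rw [ww, neg_ne_zero]; exact Polynomial.X_sub_C_ne_zero _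

/-- Frobenius pull back of a syzygy, then moved to the exponent `m`. -/
theorem lower_gap (p : ℕ) [Fact p.Prime] {m u c n : ℕ} (hu : u = 2 * c + 1)
    (h : HasSyz (ZMod p) u (3 * c + 1)) (i : ℕ)
    (hi : m = u * p ^ n + i ∨ m + i = u * p ^ n) :
    ∃ d, HasSyz (ZMod p) m d ∧ 3 * m + 3 * i = 2 * d + p ^ n := by
  obtain ⟨A, B, C, ⟨hA, hB, hC, hs⟩, hne⟩ := h
  rw [show 3 * c + 1 + 1 - u = c + 1 by omega] at hA hB hC
  have hp := (Fact.out : p.Prime)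
  set q := p ^ n with hq
  have hq0 : q ≠ 0 := pow_ne_zero _ hp.ne_zero
  have nd : ∀ P : (ZMod p)[X], P.degree < ((c + 1 : ℕ) : WithBot ℕ) →
      (P ^ q).natDegree ≤ q * c := by
    intro P hP
    have h1 : P.natDegree ≤ c := by
      by_cases h0 : P = 0
      · simp [h0]
      · have := (Polynomial.natDegree_lt_iff_degree_lt h0).2 hP
        omega
    exact Polynomial.natDegree_pow_le.trans (Nat.mul_le_mul_left _ h1)
  have hA' := nd A hA
  have hB' := nd B hB
  have hC' := nd C hC
  have hsq : Polynomial.X ^ (u * q) * A ^ q + B ^ q + ww (ZMod p) ^ (u * q) * C ^ q = 0 := by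
    have : (Polynomial.X ^ u * A + B + ww (ZMod p) ^ u * C) ^ q = 0 := by rw [hs, zero_pow hq0]
    rw [hq, add_pow_char_pow, add_pow_char_pow, ← hq, mul_pow, mul_pow, ← pow_mul, ← pow_mul]
      at this
    exact this
  have todeg : ∀ (P : (ZMod p)[X]) (N : ℕ), P.natDegree < N → P.degree < (N : WithBot ℕ) := by
    intro P N h
    exact lt_of_le_of_lt Polynomial.degree_le_natDegree (by exact_mod_cast h)
  have hq1 : 1 ≤ q := Nat.one_le_iff_ne_zero.2 hq0
  have e2 : u * q = 2 * (q * c) + q := by rw [hu]; ring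
  rcases hi with hi | hi
  · refine ⟨3 * (q * c) + q + 3 * i, ⟨ww (ZMod p) ^ i * A ^ q,
      Polynomial.X ^ i * ww (ZMod p) ^ i * B ^ q, Polynomial.X ^ i * C ^ q, ⟨?_, ?_, ?_, ?_⟩, ?_⟩, ?_⟩
    · apply todeg
      have := Polynomial.natDegree_mul_le (p := ww (ZMod p) ^ i) (q := A ^ q)
      rw [Polynomial.natDegree_pow, natDegree_ww] at this
      omega
    · apply todeg
      have := Polynomial.natDegree_mul_le (p := Polynomial.X ^ i * ww (ZMod p) ^ i) (q := B ^ q)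
      have h2 := Polynomial.natDegree_mul_le (p := Polynomial.X ^ i) (q := ww (ZMod p) ^ i)
      rw [Polynomial.natDegree_pow (ww _), natDegree_ww, Polynomial.natDegree_X_pow] at h2
      omega
    · apply todeg
      have := Polynomial.natDegree_mul_le (p := Polynomial.X ^ i) (q := C ^ q)
      rw [Polynomial.natDegree_X_pow] at this
      omega
    · rw [hi]
      linear_combination (Polynomial.X ^ i * ww (ZMod p) ^ i) * hsq
    · intro ⟨h1, h2, h3⟩
      have hX : (Polynomial.X : (ZMod p)[X]) ≠ 0 := Polynomial.X_ne_zero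
      simp [hq0, ww_ne, hX] at h1 h2 h3
      exact hne ⟨h1, h2, h3⟩
    · omega
  · refine ⟨3 * (q * c) + q, ⟨Polynomial.X ^ i * A ^ q, B ^ q, ww (ZMod p) ^ i * C ^ q,
      ⟨?_, ?_, ?_, ?_⟩, ?_⟩, ?_⟩
    · apply todeg
      have := Polynomial.natDegree_mul_le (p := Polynomial.X ^ i) (q := A ^ q)
      rw [Polynomial.natDegree_X_pow] at this
      omega
    · apply todeg
      omega
    · apply todeg
      have := Polynomial.natDegree_mul_le (p := ww (ZMod p) ^ i) (q := C ^ q)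
      rw [Polynomial.natDegree_pow, natDegree_ww] at this
      omega
    · rw [← hi] at hsq
      linear_combination hsq
    · intro ⟨h1, h2, h3⟩
      have hX : (Polynomial.X : (ZMod p)[X]) ≠ 0 := Polynomial.X_ne_zero
      simp [hq0, ww_ne, hX] at h1 h2 h3
      exact hne ⟨h1, h2, h3⟩
    · omega

theorem mem_lt {F : Type} [Field F] {P : F[X]} {n : ℕ} :
    P ∈ Polynomial.degreeLT F n ↔ P = 0 ∨ P.natDegree < n := by
  rw [Polynomial.mem_degreeLT]
  by_cases h : P = 0
  · simp [h]
  · simp [h, Polynomial.natDegree_lt_iff_degree_lt h]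

theorem mul_mem_lt {F : Type} [Field F] {P R : F[X]} {n k N : ℕ}
    (hP : P ∈ Polynomial.degreeLT F n) (hR : R ∈ Polynomial.degreeLT F k) (h : n + k ≤ N + 1) :
    P * R ∈ Polynomial.degreeLT F N := by
  rw [mem_lt] at *
  rcases hP with rfl | hP
  · simp
  rcases hR with rfl | hR
  · simp
  right
  have := Polynomial.natDegree_mul_le (p := P) (q := R)
  omega

theorem finrank_lt (F : Type) [Field F] (n : ℕ) :
    Module.finrank F (Polynomial.degreeLT F n) = n := by
  rw [(Polynomial.degreeLTEquiv F n).finrank_eq]; simp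

instance finite_lt (F : Type) [Field F] (n : ℕ) : Module.Finite F (Polynomial.degreeLT F n) :=
  Module.Finite.equiv (Polynomial.degreeLTEquiv F n).symm

theorem X_pow_mem {F : Type} [Field F] (m : ℕ) :
    (Polynomial.X : F[X]) ^ m ∈ Polynomial.degreeLT F (m + 1) := by
  rw [mem_lt]; right; simp

theorem ww_pow_mem {F : Type} [Field F] (m : ℕ) :
    (ww F) ^ m ∈ Polynomial.degreeLT F (m + 1) := by
  rw [mem_lt]; right; simp [natDegree_ww]

theorem phi_mem {F : Type} [Field F] {m L : ℕ} {A B C : F[X]}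
    (hA : A ∈ Polynomial.degreeLT F (L - m)) (hB : B ∈ Polynomial.degreeLT F (L - m))
    (hC : C ∈ Polynomial.degreeLT F (L - m)) :
    Polynomial.X ^ m * A + B + ww F ^ m * C ∈ Polynomial.degreeLT F L := by
  rcases Nat.lt_or_ge L m with h | h
  · rw [Nat.sub_eq_zero_of_le h.le, mem_lt] at hA hB hC
    simp at hA hB hC
    simp [hA, hB, hC]
  · refine Submodule.add_mem _ (Submodule.add_mem _ ?_ ?_) ?_
    · exact mul_mem_lt (X_pow_mem m) hA (by omega)
    · exact Polynomial.degreeLT_mono (by omega) hB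
    · exact mul_mem_lt (ww_pow_mem m) hC (by omega)

/-- Domain of the multiplication map. -/
abbrev Dom (F : Type) [Field F] (m L : ℕ) : Type :=
  Polynomial.degreeLT F (L - m) × Polynomial.degreeLT F (L - m) × Polynomial.degreeLT F (L - m)

/-- The degree `L-1` part of `(A,B,C) ↦ x^m A + y^m B + z^m C`. -/
noncomputable def Phi (F : Type) [Field F] (m L : ℕ) :
    Dom F m L →ₗ[F] Polynomial.degreeLT F L where
  toFun v := ⟨Polynomial.X ^ m * (v.1 : F[X]) + (v.2.1 : F[X]) + ww F ^ m * (v.2.2 : F[X]),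
    phi_mem v.1.2 v.2.1.2 v.2.2.2⟩
  map_add' v v' := by
    ext1; simp only [Prod.fst_add, Prod.snd_add, Submodule.coe_add]; ring
  map_smul' c v := by
    ext1
    simp only [Prod.smul_fst, Prod.smul_snd, Submodule.coe_smul, RingHom.id_apply, smul_add,
      mul_smul_comm]

theorem Phi_apply {F : Type} [Field F] {m L : ℕ} (v : Dom F m L) :
    (Phi F m L v : F[X]) = Polynomial.X ^ m * (v.1 : F[X]) + (v.2.1 : F[X]) + ww F ^ m * (v.2.2 : F[X]) := rfl

theorem mem_ker {F : Type} [Field F] {m L : ℕ} (v : Dom F m L) :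
    v ∈ LinearMap.ker (Phi F m L) ↔
      Polynomial.X ^ m * (v.1 : F[X]) + (v.2.1 : F[X]) + ww F ^ m * (v.2.2 : F[X]) = 0 := by
  rw [LinearMap.mem_ker, ← Phi_apply, Submodule.coe_eq_zero]

/-- Hilbert function. -/
noncomputable def hh (F : Type) [Field F] (m L : ℕ) : ℕ :=
  Module.finrank F (Polynomial.degreeLT F L ⧸ LinearMap.range (Phi F m L))

theorem hh_eq (F : Type) [Field F] (m L : ℕ) :
    hh F m L + 3 * (L - m) = L + Module.finrank F (LinearMap.ker (Phi F m L)) := by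
  have h1 := Submodule.finrank_quotient_add_finrank (LinearMap.range (Phi F m L))
  have h2 := LinearMap.finrank_range_add_finrank_ker (Phi F m L)
  rw [Module.finrank_prod, Module.finrank_prod, finrank_lt] at h2
  rw [finrank_lt] at h1
  rw [hh]
  omega

theorem ker_ne_bot {F : Type} [Field F] {m d : ℕ} :
    LinearMap.ker (Phi F m (d + 1)) ≠ ⊥ ↔ HasSyz F m d := by
  rw [Submodule.ne_bot_iff]
  constructor
  · rintro ⟨v, hv, hv0⟩
    refine ⟨v.1, v.2.1, v.2.2, ⟨Polynomial.mem_degreeLT.1 v.1.2, Polynomial.mem_degreeLT.1 v.2.1.2,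
      Polynomial.mem_degreeLT.1 v.2.2.2, (mem_ker v).1 hv⟩, ?_⟩
    rintro ⟨h1, h2, h3⟩
    apply hv0
    ext1
    · exact Subtype.ext h1
    · ext1
      · exact Subtype.ext h2
      · exact Subtype.ext h3
  · rintro ⟨A, B, C, ⟨hA, hB, hC, hs⟩, hne⟩
    refine ⟨(⟨A, Polynomial.mem_degreeLT.2 hA⟩, ⟨B, Polynomial.mem_degreeLT.2 hB⟩,
      ⟨C, Polynomial.mem_degreeLT.2 hC⟩), (mem_ker _).2 hs, ?_⟩
    intro h
    simp only [Prod.mk_eq_zero, Submodule.mk_eq_zero] at h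
    exact hne h

/-- Existence of syzygies by counting dimensions. -/
theorem exists_syz (F : Type) [Field F] (m d : ℕ) (hmd : m ≤ d + 1) (h : 3 * m < 2 * (d + 1)) :
    HasSyz F m d := by
  rw [← ker_ne_bot]
  intro hb
  have := hh_eq F m (d + 1)
  rw [hb, finrank_bot] at this
  omega

theorem hh_low (F : Type) [Field F] {m L : ℕ} (h : L ≤ m) : hh F m L = L := by
  have := hh_eq F m L
  have h2 := LinearMap.finrank_range_add_finrank_ker (Phi F m L)
  rw [Module.finrank_prod, Module.finrank_prod, finrank_lt] at h2
  omega

theorem hh_mid (F : Type) [Field F] {m d : ℕ} (h : ¬ HasSyz F m d) :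
    hh F m (d + 1) + 3 * (d + 1 - m) = d + 1 := by
  have := hh_eq F m (d + 1)
  rw [← ker_ne_bot, not_not] at h
  rw [h, finrank_bot] at this
  omega

/-- Key structural step: syzygies of low degree are multiples of the minimal one. -/
theorem mult_of_min {F : Type} [Field F] {m d L : ℕ} {A B C A' B' C' : F[X]}
    (hd : d < 2 * m)
    (hS : Syz F m d A B C) (hne : ¬ (A = 0 ∧ B = 0 ∧ C = 0))
    (hmin : ∀ d' < d, ¬ HasSyz F m d') (hL : L + d < 3 * m)
    (hS' : Syz F m L A' B' C') :
    ∃ c ∈ Polynomial.degreeLT F (L + 1 - d), A' = c * A ∧ B' = c * B ∧ C' = c * C := by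
  classical
  obtain ⟨hA0, hB0, hC0⟩ := hS.nonzero hd hne
  obtain ⟨hA, hB, hC, hs⟩ := hS
  obtain ⟨hA', hB', hC', hs'⟩ := hS'
  rw [← Polynomial.mem_degreeLT] at hA hB hC hA' hB' hC'
  have hw : ww F ^ m ≠ 0 := pow_ne_zero _ ww_ne
  have hAn := (mem_lt.1 hA).resolve_left hA0
  -- the cross product vanishes
  have hx : A * B' - A' * B = - (ww F ^ m * (A * C' - A' * C)) := by
    linear_combination A * hs' - A' * hs
  have hf : A * C' - A' * C = 0 := by
    by_contra hf
    rcases Nat.lt_or_ge L m with hlt | hge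
    · rw [Nat.sub_eq_zero_of_le (by omega : L + 1 ≤ m), mem_lt] at hA' hC'
      simp at hA' hC'
      rw [hA', hC'] at hf
      simp at hf
    · have h1 : A * B' - A' * B ∈ Polynomial.degreeLT F ((d + 1 - m) + (L + 1 - m) - 1) :=
        Submodule.sub_mem _ (mul_mem_lt hA hB' (by omega)) (mul_mem_lt hA' hB (by omega))
      rw [hx, mem_lt] at h1
      have h2 : -(ww F ^ m * (A * C' - A' * C)) ≠ 0 := neg_ne_zero.2 (mul_ne_zero hw hf)
      have h3 := h1.resolve_left h2
      rw [Polynomial.natDegree_neg, Polynomial.natDegree_mul hw hf, Polynomial.natDegree_pow,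
        natDegree_ww] at h3
      omega
  have hAB : A * B' = A' * B := by
    rw [hf] at hx; linear_combination hx
  have hAC : A * C' = A' * C := by linear_combination hf
  -- divisibility
  set G := EuclideanDomain.gcd A A' with hG
  have hG0 : G ≠ 0 := by
    intro h; rw [hG, EuclideanDomain.gcd_eq_zero_iff] at h; exact hA0 h.1
  obtain ⟨a, ha⟩ : G ∣ A := EuclideanDomain.gcd_dvd_left _ _
  obtain ⟨a', ha'⟩ : G ∣ A' := EuclideanDomain.gcd_dvd_right _ _
  have hcop : IsCoprime a a' := by
    have := EuclideanDomain.gcd_eq_gcd_ab A A'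
    refine ⟨EuclideanDomain.gcdA A A', EuclideanDomain.gcdB A A', ?_⟩
    apply mul_left_cancel₀ hG0
    rw [mul_one]
    conv_rhs => rw [hG, this]
    linear_combination (-EuclideanDomain.gcdA A A') * ha - EuclideanDomain.gcdB A A' * ha'
  have ha0 : a ≠ 0 := by rintro rfl; simp at ha; exact hA0 ha
  have hb : a ∣ B := by
    apply hcop.dvd_of_dvd_mul_left
    refine ⟨B', mul_left_cancel₀ hG0 ?_⟩
    linear_combination (-1) * hAB + B' * ha - B * ha'
  have hc : a ∣ C := by
    apply hcop.dvd_of_dvd_mul_left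
    refine ⟨C', mul_left_cancel₀ hG0 ?_⟩
    linear_combination (-1) * hAC + C' * ha - C * ha'
  obtain ⟨b, hb⟩ := hb
  obtain ⟨c, hc⟩ := hc
  have hb0 : b ≠ 0 := by rintro rfl; simp at hb; exact hB0 hb
  have hc0 : c ≠ 0 := by rintro rfl; simp at hc; exact hC0 hc
  have hBn := (mem_lt.1 hB).resolve_left hB0
  have hCn := (mem_lt.1 hC).resolve_left hC0
  have hAd : A.natDegree = G.natDegree + a.natDegree := by
    rw [ha, Polynomial.natDegree_mul hG0 ha0]
  have hBd : B.natDegree = a.natDegree + b.natDegree := by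
    rw [hb, Polynomial.natDegree_mul ha0 hb0]
  have hCd : C.natDegree = a.natDegree + c.natDegree := by
    rw [hc, Polynomial.natDegree_mul ha0 hc0]
  have hadeg : a.natDegree = 0 := by
    by_contra hpos
    apply hmin (d - 1) (by omega)
    refine ⟨G, b, c, ⟨?_, ?_, ?_, ?_⟩, fun h => hG0 h.1⟩
    · rw [← Polynomial.mem_degreeLT, mem_lt]; right; omega
    · rw [← Polynomial.mem_degreeLT, mem_lt]; right; omega
    · rw [← Polynomial.mem_degreeLT, mem_lt]; right; omega
    · apply mul_left_cancel₀ ha0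
      rw [mul_zero]
      linear_combination hs - Polynomial.X ^ m * ha - hb - ww F ^ m * hc
  have hau : IsUnit a := by
    rw [Polynomial.isUnit_iff_degree_eq_zero, Polynomial.degree_eq_natDegree ha0, hadeg]; rfl
  obtain ⟨r, hr⟩ : A ∣ A' := by
    rw [ha, ha']
    exact mul_dvd_mul_left _ (hau.dvd)
  have hrB : B' = r * B := by
    apply mul_left_cancel₀ hA0
    rw [hAB, hr]; ring
  have hrC : C' = r * C := by
    apply mul_left_cancel₀ hA0
    rw [hAC, hr]; ring
  have hrA : A' = r * A := by rw [hr]; ring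
  refine ⟨r, ?_, hrA, hrB, hrC⟩
  rw [mem_lt]
  by_cases hr0 : r = 0
  · left; exact hr0
  right
  have key : ∀ P P' : F[X], P ≠ 0 → P' = r * P → P' ∈ Polynomial.degreeLT F (L + 1 - m) →
      r.natDegree + P.natDegree < L + 1 - m := by
    intro P P' hP0 hP hm
    have := (mem_lt.1 hm).resolve_left (by rw [hP]; exact mul_ne_zero hr0 hP0)
    rwa [hP, Polynomial.natDegree_mul hr0 hP0] at this
  have k1 := key A A' hA0 hrA hA'
  have k2 := key B B' hB0 hrB hB'
  have k3 := key C C' hC0 hrC hC'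
  by_contra hcon
  apply hmin (d - 1) (by omega)
  refine ⟨A, B, C, ⟨?_, ?_, ?_, hs⟩, hne⟩
  · rw [← Polynomial.mem_degreeLT, mem_lt]; right; omega
  · rw [← Polynomial.mem_degreeLT, mem_lt]; right; omega
  · rw [← Polynomial.mem_degreeLT, mem_lt]; right; omega

theorem hh_high {F : Type} [Field F] {m d L : ℕ} (hd : d < 2 * m) (hmd : m ≤ d)
    (hS : HasSyz F m d) (hmin : ∀ d' < d, ¬ HasSyz F m d') (hdL : d ≤ L) (hL : L + d < 3 * m) :
    hh F m (L + 1) + 3 * (L + 1 - m) = (L + 1) + (L + 1 - d) := by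
  obtain ⟨A, B, C, hS, hne⟩ := hS
  have hnz := hS.nonzero hd hne
  rw [hh_eq]
  congr 1
  obtain ⟨hA, hB, hC, hs⟩ := id hS
  rw [← Polynomial.mem_degreeLT] at hA hB hC
  let ψ : Polynomial.degreeLT F (L + 1 - d) →ₗ[F] Dom F m (L + 1) :=
    { toFun := fun c => (⟨(c : F[X]) * A, mul_mem_lt c.2 hA (by omega)⟩,
        ⟨(c : F[X]) * B, mul_mem_lt c.2 hB (by omega)⟩, ⟨(c : F[X]) * C, mul_mem_lt c.2 hC (by omega)⟩)
      map_add' := by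
        intro c c'
        ext1
        · ext1; simp [add_mul]
        · ext1 <;> ext1 <;> simp [add_mul]
      map_smul' := by
        intro r c
        ext1
        · ext1; simp
        · ext1 <;> ext1 <;> simp }
  have hinj : Function.Injective ψ := by
    intro c c' h
    have h1 : (c : F[X]) * A = c' * A := congrArg (fun v : Dom F m (L + 1) => (v.1 : F[X])) h
    exact Subtype.ext (mul_right_cancel₀ hnz.1 h1)
  have hr : LinearMap.range ψ = LinearMap.ker (Phi F m (L + 1)) := by
    apply le_antisymm
    · rintro _ ⟨c, rfl⟩
      rw [mem_ker]
      change Polynomial.X ^ m * ((c : F[X]) * A) + (c : F[X]) * B + ww F ^ m * ((c : F[X]) * C) = 0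
      linear_combination (c : F[X]) * hs
    · intro v hv
      rw [mem_ker] at hv
      obtain ⟨c, hc, h1, h2, h3⟩ := mult_of_min hd hS hne hmin hL
        ⟨Polynomial.mem_degreeLT.1 v.1.2, Polynomial.mem_degreeLT.1 v.2.1.2,
          Polynomial.mem_degreeLT.1 v.2.2.2, hv⟩
      refine ⟨⟨c, hc⟩, ?_⟩
      ext1
      · exact Subtype.ext h1.symm
      · ext1
        · exact Subtype.ext h2.symm
        · exact Subtype.ext h3.symm
  rw [← hr, LinearMap.finrank_range_of_inj hinj, finrank_lt]

theorem hh_zero_succ {F : Type} [Field F] {m L : ℕ} (hL : 1 ≤ L) (h : hh F m L = 0) :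
    hh F m (L + 1) = 0 := by
  rw [hh, Module.finrank_eq_zero_iff_of_free, Submodule.Quotient.subsingleton_iff] at h ⊢
  rw [LinearMap.range_eq_top] at h ⊢
  have hmono := Polynomial.degreeLT_mono (R := F) (show L - m ≤ L + 1 - m by omega)
  have key : ∀ P ∈ Polynomial.degreeLT F L, ∃ v, (Phi F m (L + 1) v : F[X]) = P := by
    intro P hP
    obtain ⟨v, hv⟩ := h ⟨P, hP⟩
    refine ⟨(⟨v.1, hmono v.1.2⟩, ⟨v.2.1, hmono v.2.1.2⟩, ⟨v.2.2, hmono v.2.2.2⟩), ?_⟩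
    have := congrArg Subtype.val hv
    rw [Phi_apply] at this
    exact this
  have keyX : ∀ P ∈ Polynomial.degreeLT F L, ∃ v, (Phi F m (L + 1) v : F[X]) = P * Polynomial.X := by
    intro P hP
    obtain ⟨v, hv⟩ := h ⟨P, hP⟩
    have hX : ∀ w ∈ Polynomial.degreeLT F (L - m), w * Polynomial.X ∈
        Polynomial.degreeLT F (L + 1 - m) := by
      intro w hw
      rcases Nat.lt_or_ge L m with h | h
      · rw [Nat.sub_eq_zero_of_le h.le, mem_lt] at hw
        simp at hw
        simp [hw]
      · have := X_pow_mem (F := F) 1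
        rw [pow_one] at this
        exact mul_mem_lt hw this (by omega)
    refine ⟨(⟨_, hX v.1 v.1.2⟩, ⟨_, hX v.2.1 v.2.1.2⟩, ⟨_, hX v.2.2 v.2.2.2⟩), ?_⟩
    have := congrArg Subtype.val hv
    rw [Phi_apply] at this
    rw [Phi_apply]
    simp only at this ⊢
    rw [← this]; ring
  intro P
  obtain ⟨v1, h1⟩ := keyX (Polynomial.divX P) (by
    have := P.2
    rw [mem_lt] at this ⊢
    rcases this with h | h
    · left; rw [h]; simp
    · right; rw [Polynomial.natDegree_divX_eq_natDegree_tsub_one]; omega)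
  obtain ⟨v2, h2⟩ := key (Polynomial.C ((P : F[X]).coeff 0)) (by
    rw [mem_lt]; right; rw [Polynomial.natDegree_C]; omega)
  refine ⟨v1 + v2, Subtype.ext ?_⟩
  rw [map_add, Submodule.coe_add, h1, h2, Polynomial.divX_mul_X_add]

/-- The colength as the sum of the Hilbert function. -/
noncomputable def DD (F : Type) [Field F] (m : ℕ) : ℕ := ∑ n ∈ Finset.range (3 * m), hh F m (n + 1)

theorem exists_min (F : Type) [Field F] {m : ℕ} (hm : 1 ≤ m) :
    ∃ d, HasSyz F m d ∧ (∀ d' < d, ¬ HasSyz F m d') ∧ m ≤ d ∧ 2 * d ≤ 3 * m := by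
  classical
  have hex : ∃ d, HasSyz F m d := ⟨2 * m, exists_syz F m _ (by omega) (by omega)⟩
  have hmin : ∀ d' < Nat.find hex, ¬ HasSyz F m d' := fun d' h => Nat.find_min hex h
  have hle : m ≤ Nat.find hex := by
    by_contra hlt
    obtain ⟨A, B, C, ⟨hA, hB, hC, -⟩, hne⟩ := Nat.find_spec hex
    rw [Nat.sub_eq_zero_of_le (by omega)] at hA hB hC
    rw [← Polynomial.mem_degreeLT, mem_lt] at hA hB hC
    simp at hA hB hC
    exact hne ⟨hA, hB, hC⟩
  refine ⟨Nat.find hex, Nat.find_spec hex, hmin, hle, ?_⟩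
  by_contra hlt
  exact hmin (Nat.find hex - 1) (by omega) (exists_syz F m _ (by omega) (by omega))

theorem DD_formula (F : Type) [Field F] {m d : ℕ} (hm : 1 ≤ m) (hS : HasSyz F m d)
    (hmin : ∀ d' < d, ¬ HasSyz F m d') (hmd : m ≤ d) (h2 : 2 * d ≤ 3 * m) :
    DD F m + 3 * m * d = 3 * m ^ 2 + d ^ 2 := by
  have hmid : ∀ n, m ≤ n → n < d → (hh F m (n + 1) : ℤ) = 3 * m - 2 * (n + 1) := by
    intro n h1 h2
    have := hh_mid F (hmin n h2)
    omega
  have hhigh : ∀ n, d ≤ n → n + d < 3 * m → (hh F m (n + 1) : ℤ) = 3 * m - d - (n + 1) := by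
    intro n h1 h3
    have := hh_high (by omega) hmd hS hmin h1 h3
    omega
  have hz0 : hh F m (3 * m - d) = 0 := by
    rcases Nat.lt_or_ge (2 * d) (3 * m) with h | h
    · have := hhigh (3 * m - d - 1) (by omega) (by omega)
      rw [Nat.sub_add_cancel (by omega)] at this
      omega
    · have := hmid (3 * m - d - 1) (by omega) (by omega)
      rw [Nat.sub_add_cancel (by omega)] at this
      omega
  have hz : ∀ n, 3 * m - d ≤ n → hh F m n = 0 := by
    intro n hn
    induction n, hn using Nat.le_induction with
    | base => exact hz0
    | succ n hn ih => exact hh_zero_succ (by omega) ih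
  have s1 : ∀ n, n ≤ m → (2 * ∑ k ∈ Finset.range n, hh F m (k + 1) : ℕ) = (n * (n + 1) : ℤ) := by
    intro n
    induction n with
    | zero => simp
    | succ n ih =>
      intro hn
      have h := ih (by omega)
      rw [Finset.sum_range_succ, hh_low F hn]
      push_cast at h ⊢
      linarith
  have s2 : ∀ n, m ≤ n → n ≤ d → ((2 * ∑ k ∈ Finset.range n, hh F m (k + 1) : ℕ) : ℤ) =
      m * (m + 1) + 6 * m * (n - m) - 2 * (n * (n + 1) - m * (m + 1)) := by
    intro n hn
    induction n, hn using Nat.le_induction with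
    | base => intro _; rw [s1 m le_rfl]; ring
    | succ n hn ih =>
      intro hd
      have h := ih (by omega)
      have h' := hmid n hn (by omega)
      rw [Finset.sum_range_succ]
      push_cast at h ⊢
      rw [h']
      linarith
  have s3 : ∀ n, d ≤ n → n + d ≤ 3 * m → ((2 * ∑ k ∈ Finset.range n, hh F m (k + 1) : ℕ) : ℤ) =
      m * (m + 1) + 6 * m * (d - m) - 2 * (d * (d + 1) - m * (m + 1)) +
        2 * (3 * m - d) * (n - d) - (n * (n + 1) - d * (d + 1)) := by
    intro n hn
    induction n, hn using Nat.le_induction with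
    | base => intro _; rw [s2 d hmd le_rfl]; ring
    | succ n hn ih =>
      intro hd
      have h := ih (by omega)
      have h' := hhigh n hn (by omega)
      rw [Finset.sum_range_succ]
      push_cast at h ⊢
      rw [h']
      linarith
  have s4 : ∀ n, 3 * m - d ≤ n → ∑ k ∈ Finset.range n, hh F m (k + 1) =
      ∑ k ∈ Finset.range (3 * m - d), hh F m (k + 1) := by
    intro n hn
    induction n, hn using Nat.le_induction with
    | base => rfl
    | succ n hn ih => rw [Finset.sum_range_succ, ih, hz _ (by omega), add_zero]
  have e := s3 (3 * m - d) (by omega) (by omega)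
  rw [DD, s4 _ (by omega)]
  rw [Nat.cast_sub (by omega)] at e
  zify
  push_cast at e
  nlinarith

/-- The ideal `(x^e+y^e+z^e, x^m, y^m, z^m)`. -/
noncomputable def JJ (F : Type) [Field F] (e m : ℕ) : Ideal (MvPolynomial (Fin 3) F) :=
  Ideal.span (insert (∑ i : Fin 3, (X i : MvPolynomial (Fin 3) F) ^ e)
      (Set.range fun i : Fin 3 => (X i : MvPolynomial (Fin 3) F) ^ m))

theorem sum_mem (F : Type) [Field F] (e m : ℕ) :
    ∑ i : Fin 3, (X i : MvPolynomial (Fin 3) F) ^ e ∈ JJ F e m :=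
  Ideal.subset_span (Set.mem_insert _ _)

theorem pow_mem' (F : Type) [Field F] (e m : ℕ) (i : Fin 3) :
    (X i : MvPolynomial (Fin 3) F) ^ m ∈ JJ F e m :=
  Ideal.subset_span (Set.mem_insert_of_mem _ ⟨i, rfl⟩)

/-- Dehomogenisation. -/
noncomputable def ev (F : Type) [Field F] : MvPolynomial (Fin 3) F →ₐ[F] F[X] :=
  aeval ![Polynomial.X, 1, ww F]

theorem ev_mem {F : Type} [Field F] {f : MvPolynomial (Fin 3) F} {n : ℕ} (hf : f.IsHomogeneous n) :
    ev F f ∈ Polynomial.degreeLT F (n + 1) := by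
  rw [mem_lt]
  right
  have := MvPolynomial.aeval_natDegree_le (n := 1) f hf.totalDegree_le ![Polynomial.X, 1, ww F] (by
    intro i
    fin_cases i
    · simp
    · simp
    · simp [natDegree_ww])
  rw [ev]
  omega

/-- Degree `n` part, dehomogenised. -/
noncomputable def evn (F : Type) [Field F] (n : ℕ) :
    MvPolynomial (Fin 3) F →ₗ[F] Polynomial.degreeLT F (n + 1) :=
  LinearMap.codRestrict _ ((ev F).toLinearMap.comp (homogeneousComponent n))
    (fun f => ev_mem (homogeneousComponent_isHomogeneous n f))

theorem evn_apply {F : Type} [Field F] (n : ℕ) (f : MvPolynomial (Fin 3) F) :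
    (evn F n f : F[X]) = ev F (homogeneousComponent n f) := rfl

/-- The graded piece. -/
def Gr (F : Type) [Field F] (m L : ℕ) : Type :=
  Polynomial.degreeLT F L ⧸ LinearMap.range (Phi F m L)

noncomputable instance (F : Type) [Field F] (m L : ℕ) : AddCommGroup (Gr F m L) :=
  inferInstanceAs (AddCommGroup (Polynomial.degreeLT F L ⧸ LinearMap.range (Phi F m L)))

noncomputable instance (F : Type) [Field F] (m L : ℕ) : Module F (Gr F m L) :=
  inferInstanceAs (Module F (Polynomial.degreeLT F L ⧸ LinearMap.range (Phi F m L)))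

instance (F : Type) [Field F] (m L : ℕ) : Module.Finite F (Gr F m L) :=
  inferInstanceAs (Module.Finite F (Polynomial.degreeLT F L ⧸ LinearMap.range (Phi F m L)))

theorem finrank_Gr (F : Type) [Field F] (m L : ℕ) : Module.finrank F (Gr F m L) = hh F m L := rfl

/-- The projection to the graded piece. -/
noncomputable def mkGr (F : Type) [Field F] (m L : ℕ) :
    Polynomial.degreeLT F L →ₗ[F] Gr F m L :=
  Submodule.mkQ (LinearMap.range (Phi F m L))

theorem mkGr_surj (F : Type) [Field F] (m L : ℕ) : Function.Surjective (mkGr F m L) :=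
  Submodule.mkQ_surjective _

theorem mkGr_eq_zero {F : Type} [Field F] {m L : ℕ} (P : Polynomial.degreeLT F L) :
    mkGr F m L P = 0 ↔ ∃ v, Phi F m L v = P :=
  Submodule.Quotient.mk_eq_zero _

/-- The graded evaluation map. -/
noncomputable def pim (F : Type) [Field F] (m : ℕ) :
    MvPolynomial (Fin 3) F →ₗ[F]
      ((n : Fin (3 * m)) → Gr F m (n + 1)) :=
  LinearMap.pi fun n => (mkGr F m (n + 1)).comp (evn F n)

theorem pim_eq_zero {F : Type} [Field F] {m : ℕ} {f : MvPolynomial (Fin 3) F} :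
    pim F m f = 0 ↔ ∀ n < 3 * m, ∃ v, (Phi F m (n + 1) v : F[X]) = ev F (homogeneousComponent n f) := by
  constructor
  · intro h n hn
    have h1 := congrFun h ⟨n, hn⟩
    have h2 : mkGr F m (n + 1) (evn F n f) = 0 := h1
    rw [mkGr_eq_zero] at h2
    obtain ⟨v, hv⟩ := h2
    exact ⟨v, by rw [hv, evn_apply]⟩
  · intro h
    funext n
    obtain ⟨v, hv⟩ := h n n.2
    change mkGr F m (n + 1) (evn F n f) = 0
    rw [mkGr_eq_zero]
    exact ⟨v, Subtype.ext hv⟩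

theorem pim_add {F : Type} [Field F] {m : ℕ} {f g : MvPolynomial (Fin 3) F}
    (hf : pim F m f = 0) (hg : pim F m g = 0) : pim F m (f + g) = 0 := by
  rw [pim_eq_zero] at *
  intro n hn
  obtain ⟨v, hv⟩ := hf n hn
  obtain ⟨w, hw⟩ := hg n hn
  exact ⟨v + w, by rw [map_add, map_add, map_add, ← hv, ← hw]; rfl⟩

theorem pim_surj (F : Type) [Field F] (m : ℕ) : Function.Surjective (pim F m) := by
  intro u
  have h : ∀ n : Fin (3 * m), ∃ P : Polynomial.degreeLT F (n + 1),
      mkGr F m (n + 1) P = u n :=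
    fun n => mkGr_surj _ _ _ (u n)
  choose P hP using h
  have hhom : ∀ (n : ℕ) (Q : F[X]),
      (rename (Fin.castSucc) (Polynomial.homogenize Q n) : MvPolynomial (Fin 3) F).IsHomogeneous n :=
    fun n Q => (Polynomial.isHomogeneous_homogenize Q).rename_isHomogeneous
  refine ⟨∑ n : Fin (3 * m), rename Fin.castSucc (Polynomial.homogenize (P n : F[X]) n), ?_⟩
  funext n
  rw [← hP n]
  change mkGr F m (n + 1) (evn F n _) = _
  congr 1
  apply Subtype.ext
  rw [evn_apply, map_sum, Finset.sum_eq_single n]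
  · rw [homogeneousComponent_eq_self (hhom _ _), ev, aeval_rename]
    have := Polynomial.aeval_homogenize_X_one (P n : F[X]) (n := n) (by
      rcases mem_lt.1 (P n).2 with h | h
      · rw [h]; simp
      · omega)
    convert this using 3
    funext i
    fin_cases i <;> rfl
  · intro b _ hb
    rw [homogeneousComponent_of_mem (hhom _ _), if_neg]
    intro h; exact hb (Fin.ext h.symm)
  · simp

theorem pim_JJ (F : Type) [Field F] (m : ℕ) {f : MvPolynomial (Fin 3) F} (hf : f ∈ JJ F 1 m) :
    pim F m f = 0 := by
  -- products of a polynomial with a generator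
  have key : ∀ (g : MvPolynomial (Fin 3) F) (e : ℕ), g.IsHomogeneous e →
      (∀ (k : ℕ), ∀ P ∈ Polynomial.degreeLT F (k + 1), ∃ v,
        (Phi F m (k + e + 1) v : F[X]) = P * ev F g) →
      ∀ a : MvPolynomial (Fin 3) F, pim F m (a * g) = 0 := by
    intro g e hg hv a
    induction a using MvPolynomial.induction_on' with
    | monomial u c =>
      rw [pim_eq_zero]
      intro n hn
      have hmon : (monomial u c : MvPolynomial (Fin 3) F).IsHomogeneous u.degree :=
        isHomogeneous_monomial _ rfl
      rw [homogeneousComponent_of_mem (hmon.mul hg)]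
      split_ifs with h
      · subst h
        rw [map_mul]
        exact hv _ _ (ev_mem hmon)
      · exact ⟨0, by simp⟩
    | add a b ha hb => rw [add_mul]; exact pim_add ha hb
  have hpow : ∀ (i : Fin 3) a, pim F m (a * (X i : MvPolynomial (Fin 3) F) ^ m) = 0 := by
    intro i
    apply key _ m (isHomogeneous_X_pow i m)
    intro k P hP
    have hP' : P ∈ Polynomial.degreeLT F (k + m + 1 - m) := by
      rwa [show k + m + 1 - m = k + 1 by omega]
    fin_cases i
    · refine ⟨(⟨P, hP'⟩, 0, 0), ?_⟩
      rw [Phi_apply]; simp [ev, mul_comm]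
    · refine ⟨(0, ⟨P, hP'⟩, 0), ?_⟩
      rw [Phi_apply]; simp [ev]
    · refine ⟨(0, 0, ⟨P, hP'⟩), ?_⟩
      rw [Phi_apply]; simp [ev, mul_comm]
  have hsum : ∀ a, pim F m (a * ∑ i : Fin 3, (X i : MvPolynomial (Fin 3) F) ^ 1) = 0 := by
    apply key _ 1 (IsHomogeneous.sum _ _ _ fun i _ => isHomogeneous_X_pow i 1)
    intro k P hP
    refine ⟨0, ?_⟩
    simp only [map_zero, Submodule.coe_zero, pow_one, Fin.sum_univ_three]
    simp [ev, ww]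
  suffices h : ∀ a, pim F m (a * f) = 0 by simpa using h 1
  rw [JJ] at hf
  induction hf using Submodule.span_induction with
  | mem x hx =>
    rcases hx with rfl | ⟨i, rfl⟩
    · exact hsum
    · exact hpow i
  | zero => intro a; rw [mul_zero, map_zero]
  | add x y _ _ hx hy => intro a; rw [mul_add]; exact pim_add (hx a) (hy a)
  | smul b x _ hx => intro a; rw [smul_eq_mul, ← mul_assoc]; exact hx _

/-- Elimination of the third variable. -/
noncomputable def tau (F : Type) [Field F] : MvPolynomial (Fin 3) F →ₐ[F] MvPolynomial (Fin 2) F :=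
  aeval ![X 0, X 1, -(X 0 + X 1)]

theorem homog_ev {F : Type} [Field F] {f : MvPolynomial (Fin 3) F} {n : ℕ} (hf : f.IsHomogeneous n) :
    Polynomial.homogenize (ev F f) n = tau F f := by
  apply Polynomial.homogenize_eq_of_isHomogeneous
  · have := hf.aeval (n := 1) (![X 0, X 1, -(X 0 + X 1)] : Fin 3 → MvPolynomial (Fin 2) F) (by
      intro i
      fin_cases i
      · exact isHomogeneous_X F 0
      · exact isHomogeneous_X F 1
      · exact ((isHomogeneous_X F 0).add (isHomogeneous_X F 1)).neg)
    rw [one_mul] at this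
    exact this
  · have : (aeval ![Polynomial.X, 1]).comp (tau F) = ev F := by
      apply MvPolynomial.algHom_ext
      intro i
      fin_cases i
      · simp [tau, ev]
      · simp [tau, ev]
      · simp [tau, ev, ww]
    rw [← this]; rfl

theorem ker_pim_le (F : Type) [Field F] (m : ℕ) {f : MvPolynomial (Fin 3) F} (hf : pim F m f = 0) :
    f ∈ JJ F 1 m := by
  rw [pim_eq_zero] at hf
  rw [← sum_homogeneousComponent f]
  refine Ideal.sum_mem _ fun n _ => ?_
  have hhom := homogeneousComponent_isHomogeneous n f
  rcases Nat.lt_or_ge n (3 * m) with hn | hn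
  · obtain ⟨v, hv⟩ := hf n hn
    set g := homogeneousComponent n f with hg
    -- work in the quotient
    let q : MvPolynomial (Fin 3) F →ₐ[F] MvPolynomial (Fin 3) F ⧸ JJ F 1 m :=
      Ideal.Quotient.mkₐ F _
    let th : MvPolynomial (Fin 2) F →ₐ[F] MvPolynomial (Fin 3) F ⧸ JJ F 1 m :=
      aeval ![q (X 0), q (X 1)]
    have hq0 : ∀ a ∈ JJ F 1 m, q a = 0 := fun a ha => Ideal.Quotient.eq_zero_iff_mem.2 ha
    have hs : q (X 0) + q (X 1) + q (X 2) = 0 := by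
      have := hq0 _ (sum_mem F 1 m)
      simpa [Fin.sum_univ_three] using this
    have hp : ∀ i : Fin 3, q (X i) ^ m = 0 := by
      intro i
      rw [← map_pow]; exact hq0 _ (pow_mem' F 1 m i)
    have hth : th.comp (tau F) = q := by
      apply MvPolynomial.algHom_ext
      intro i
      fin_cases i
      · simp [tau, th]
      · simp [tau, th]
      · simp [tau, th]; linear_combination (-1 : MvPolynomial (Fin 3) F ⧸ JJ F 1 m) * hs
    have hgq : q g = th (Polynomial.homogenize (ev F g) n) := by
      rw [homog_ev hhom, ← hth]; rfl
    apply Ideal.Quotient.eq_zero_iff_mem.1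
    change q g = 0
    rw [hgq, ← hv, Phi_apply]
    rcases Nat.lt_or_ge n m with hnm | hnm
    · have hz : ∀ P ∈ Polynomial.degreeLT F (n + 1 - m), P = 0 := by
        intro P hP
        rw [Nat.sub_eq_zero_of_le hnm, mem_lt] at hP
        simpa using hP
      rw [hz _ v.1.2, hz _ v.2.1.2, hz _ v.2.2.2]
      simp
    · obtain ⟨k, rfl⟩ := Nat.exists_eq_add_of_le hnm
      have hd : ∀ P ∈ Polynomial.degreeLT F (m + k + 1 - m), P.natDegree ≤ k := by
        intro P hP
        rcases mem_lt.1 hP with rfl | h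
        · simp
        · omega
      have e1 : Polynomial.homogenize (Polynomial.X ^ m : F[X]) m = tau F (X 0 ^ m) := by
        rw [← homog_ev (isHomogeneous_X_pow 0 m)]; simp [ev]
      have e2 : Polynomial.homogenize (1 : F[X]) m = tau F (X 1 ^ m) := by
        rw [← homog_ev (isHomogeneous_X_pow 1 m)]; simp [ev]
      have e3 : Polynomial.homogenize (ww F ^ m) m = tau F (X 2 ^ m) := by
        rw [← homog_ev (isHomogeneous_X_pow 2 m)]; simp [ev]
      have e4 : ∀ i : Fin 3, th (tau F (X i ^ m)) = 0 := by
        intro i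
        have : th (tau F (X i ^ m)) = q (X i ^ m) := by rw [← hth]; rfl
        rw [this, map_pow, hp]
      rw [Polynomial.homogenize_add, Polynomial.homogenize_add,
        Polynomial.homogenize_mul _ _ (by simp) (hd _ v.1.2),
        Polynomial.homogenize_mul _ _ (by simp [natDegree_ww]) (hd _ v.2.2.2),
        ← one_mul (v.2.1 : F[X]), Polynomial.homogenize_mul _ _ (by simp) (hd _ v.2.1.2),
        e1, e2, e3]
      simp only [map_add, map_mul, e4, zero_mul, add_zero]
  · rw [(homogeneousComponent n f).as_sum]
    refine Ideal.sum_mem _ fun u hu => ?_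
    have hu' : u.degree = n := by
      by_contra h
      exact mem_support_iff.1 hu (hhom.coeff_eq_zero h)
    rw [Finsupp.degree_eq_sum, Fin.sum_univ_three] at hu'
    obtain ⟨i, hi⟩ : ∃ i, m ≤ u i := by
      by_contra! h
      have := h 0
      have := h 1
      have := h 2
      omega
    have : u = (u - Finsupp.single i m) + Finsupp.single i m := by
      rw [tsub_add_cancel_of_le]
      rwa [Finsupp.single_le_iff]
    rw [this, monomial_add_single]
    exact Ideal.mul_mem_left _ _ (pow_mem' F 1 m i)

theorem ker_pim (F : Type) [Field F] (m : ℕ) :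
    (JJ F 1 m).restrictScalars F = LinearMap.ker (pim F m) := by
  ext f
  rw [Submodule.restrictScalars_mem, LinearMap.mem_ker]
  exact ⟨pim_JJ F m, ker_pim_le F m⟩

/-- Passing to the kernel of the graded evaluation map. -/
noncomputable def quotEquiv₁ (F : Type) [Field F] (m : ℕ) :
    (MvPolynomial (Fin 3) F ⧸ JJ F 1 m) ≃ₗ[F] (MvPolynomial (Fin 3) F ⧸ LinearMap.ker (pim F m)) :=
  (Submodule.Quotient.restrictScalarsEquiv F (JJ F 1 m)).symm.trans
    (Submodule.quotEquivOfEq _ _ (ker_pim F m))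

/-- The quotient as a product of graded pieces. -/
noncomputable def quotEquiv (F : Type) [Field F] (m : ℕ) :
    (MvPolynomial (Fin 3) F ⧸ JJ F 1 m) ≃ₗ[F]
      ((n : Fin (3 * m)) → Gr F m (n + 1)) :=
  (quotEquiv₁ F m).trans ((pim F m).quotKerEquivOfSurjective (pim_surj F m))

theorem finite_one (F : Type) [Field F] (m : ℕ) :
    Module.Finite F (MvPolynomial (Fin 3) F ⧸ JJ F 1 m) :=
  Module.Finite.equiv (quotEquiv F m).symm

theorem finrank_one (F : Type) [Field F] (m : ℕ) :
    Module.finrank F (MvPolynomial (Fin 3) F ⧸ JJ F 1 m) = DD F m := by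
  rw [(quotEquiv F m).finrank_eq, Module.finrank_pi_fintype, DD,
    ← Fin.sum_univ_eq_sum_range (fun n => hh F m (n + 1))]
  rfl

/-- Shorthand for the polynomial ring. -/
abbrev PP (F : Type) [Field F] : Type := MvPolynomial (Fin 3) F

/-- Exponents divided by four. -/
noncomputable def dv (u : Fin 3 →₀ ℕ) : Fin 3 →₀ ℕ := u.mapRange (fun k => k / 4) (by norm_num)

open Classical in
/-- The component of residue class `r`. -/
noncomputable def cr (F : Type) [Field F] (r : Fin 3 → Fin 4) : PP F →ₗ[F] PP F :=
  (basisMonomials (Fin 3) F).constr F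
    (fun u => if (∀ i, u i % 4 = r i) then monomial (dv u) 1 else 0)

open Classical in
theorem cr_monomial {F : Type} [Field F] (r : Fin 3 → Fin 4) (u : Fin 3 →₀ ℕ) (c : F) :
    cr F r (monomial u c) = if (∀ i, u i % 4 = r i) then monomial (dv u) c else 0 := by
  have h : (monomial u c : PP F) = c • (basisMonomials (Fin 3) F u) := by
    rw [coe_basisMonomials, smul_monomial, smul_eq_mul, mul_one]
  rw [h, map_smul, cr, Module.Basis.constr_basis]
  split_ifs
  · rw [smul_monomial, smul_eq_mul, mul_one]
  · simp

theorem expand_mon {F : Type} [Field F] (v : Fin 3 →₀ ℕ) (c : F) :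
    expand 4 (monomial v c : PP F) = monomial (4 • v) c := by
  rw [expand_monomial]

theorem cr_expand {F : Type} [Field F] (r : Fin 3 → Fin 4) (a b : PP F) :
    cr F r (expand 4 a * b) = a * cr F r b := by
  classical
  induction a using MvPolynomial.induction_on' with
  | add a a' h h' => rw [map_add, add_mul, map_add, h, h', add_mul]
  | monomial v c =>
    induction b using MvPolynomial.induction_on' with
    | add a a' h h' => rw [mul_add, map_add, h, h', map_add, mul_add]
    | monomial u e =>
      rw [expand_mon, monomial_mul, cr_monomial, cr_monomial]
      have h1 : (∀ i, (4 • v + u) i % 4 = r i) ↔ (∀ i, u i % 4 = r i) := by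
        simp
      have h2 : dv (4 • v + u) = v + dv u := by
        ext i
        simp [dv]
        omega
      simp only [h1, h2]
      split_ifs
      · rw [monomial_mul]
      · simp

/-- The residue monomial. -/
noncomputable def xr (F : Type) [Field F] (r : Fin 3 → Fin 4) : PP F :=
  monomial (Finsupp.equivFunOnFinite.symm fun i => (r i : ℕ)) 1

theorem cr_xr {F : Type} [Field F] (r s : Fin 3 → Fin 4) :
    cr F r (xr F s) = if r = s then 1 else 0 := by
  classical
  rw [xr, cr_monomial]
  have h1 : (∀ i, (Finsupp.equivFunOnFinite.symm fun i => (s i : ℕ)) i % 4 = r i) ↔ r = s := by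
    simp only [Finsupp.equivFunOnFinite_symm_apply_apply]
    constructor
    · intro h
      funext i
      have := h i
      apply Fin.ext
      have := (s i).2
      omega
    · rintro rfl i
      have := (r i).2
      omega
  simp only [h1]
  split_ifs
  · have : dv (Finsupp.equivFunOnFinite.symm fun i => (s i : ℕ)) = 0 := by
      ext i
      simp [dv]
    rw [this]; rfl
  · rfl

theorem sum_cr {F : Type} [Field F] (b : PP F) : ∑ r, expand 4 (cr F r b) * xr F r = b := by
  classical
  induction b using MvPolynomial.induction_on' with
  | add a a' h h' =>
    conv_rhs => rw [← h, ← h']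
    rw [← Finset.sum_add_distrib]
    simp only [map_add, add_mul]
  | monomial u c =>
    let r : Fin 3 → Fin 4 := fun i => ⟨u i % 4, Nat.mod_lt _ (by norm_num)⟩
    rw [Finset.sum_eq_single r]
    · rw [cr_monomial, if_pos (fun i => rfl), expand_mon, xr, monomial_mul, mul_one]
      have hu : 4 • dv u + (Finsupp.equivFunOnFinite.symm fun i => ((r i : Fin 4) : ℕ)) = u := by
        ext i
        simp only [dv, r, Finsupp.add_apply, Finsupp.smul_apply, Finsupp.mapRange_apply,
          Finsupp.equivFunOnFinite_symm_apply_apply, smul_eq_mul]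
        omega
      rw [hu]
    · intro s _ hs
      rw [cr_monomial, if_neg, map_zero, zero_mul]
      intro h
      apply hs
      funext i
      exact Fin.ext (h i).symm
    · simp

theorem JJ_map (F : Type) [Field F] (m : ℕ) :
    JJ F 4 (4 * m) = Ideal.map (expand 4 : PP F →ₐ[F] PP F) (JJ F 1 m) := by
  rw [JJ, JJ, Ideal.map_span, Set.image_insert_eq, ← Set.range_comp]
  congr 2
  · simp
  · congr 1
    funext i
    simp [pow_mul]

theorem mem_JJ_four {F : Type} [Field F] {m : ℕ} {b : PP F} :
    b ∈ JJ F 4 (4 * m) ↔ ∀ r, cr F r b ∈ JJ F 1 m := by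
  constructor
  · intro hb r
    rw [JJ_map, Ideal.map] at hb
    suffices h : ∀ a, cr F r (a * b) ∈ JJ F 1 m by simpa using h 1
    induction hb using Submodule.span_induction with
    | mem x hx =>
      obtain ⟨g, hg, rfl⟩ := hx
      intro a
      rw [mul_comm]
      change cr F r (expand 4 g * a) ∈ _
      rw [cr_expand]
      exact Ideal.mul_mem_right _ _ hg
    | zero => simp
    | add x y _ _ hx hy => intro a; rw [mul_add, map_add]; exact Ideal.add_mem _ (hx a) (hy a)
    | smul c x _ hx => intro a; rw [smul_eq_mul, ← mul_assoc]; exact hx _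
  · intro h
    rw [← sum_cr b, JJ_map]
    exact Ideal.sum_mem _ fun r _ => Ideal.mul_mem_right _ _ (Ideal.mem_map_of_mem _ (h r))

/-- The combined splitting map. -/
noncomputable def rho (F : Type) [Field F] (m : ℕ) :
    PP F →ₗ[F] ((Fin 3 → Fin 4) → (PP F ⧸ JJ F 1 m)) :=
  LinearMap.pi fun r => (Ideal.Quotient.mkₐ F (JJ F 1 m)).toLinearMap.comp (cr F r)

theorem rho_surj (F : Type) [Field F] (m : ℕ) : Function.Surjective (rho F m) := by
  intro u
  have h : ∀ r, ∃ a : PP F, Ideal.Quotient.mkₐ F (JJ F 1 m) a = u r :=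
    fun r => Ideal.Quotient.mkₐ_surjective F _ (u r)
  choose a ha using h
  refine ⟨∑ r, expand 4 (a r) * xr F r, ?_⟩
  funext r
  rw [← ha r]
  change Ideal.Quotient.mkₐ F (JJ F 1 m) (cr F r _) = _
  congr 1
  simp [map_sum, cr_expand, cr_xr]

theorem ker_rho (F : Type) [Field F] (m : ℕ) :
    (JJ F 4 (4 * m)).restrictScalars F = LinearMap.ker (rho F m) := by
  ext b
  rw [Submodule.restrictScalars_mem, LinearMap.mem_ker, mem_JJ_four, funext_iff]
  refine forall_congr' fun r => ?_
  exact Ideal.Quotient.eq_zero_iff_mem.symm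

/-- The quotient is a direct sum of 64 copies. -/
noncomputable def quotEquivFour (F : Type) [Field F] (m : ℕ) :
    (PP F ⧸ JJ F 4 (4 * m)) ≃ₗ[F] ((Fin 3 → Fin 4) → (PP F ⧸ JJ F 1 m)) :=
  ((Submodule.Quotient.restrictScalarsEquiv F (JJ F 4 (4 * m))).symm.trans
    (Submodule.quotEquivOfEq _ _ (ker_rho F m))).trans
    ((rho F m).quotKerEquivOfSurjective (rho_surj F m))

theorem finite_four (F : Type) [Field F] (m : ℕ) : Module.Finite F (PP F ⧸ JJ F 4 (4 * m)) :=
  haveI := finite_one F m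
  Module.Finite.equiv (quotEquivFour F m).symm

theorem finrank_four (F : Type) [Field F] (m : ℕ) :
    Module.finrank F (PP F ⧸ JJ F 4 (4 * m)) = 64 * DD F m := by
  have := finite_one F m
  rw [(quotEquivFour F m).finrank_eq, Module.finrank_pi_fintype]
  simp [finrank_one]

theorem JJ_anti (F : Type) [Field F] {e a b : ℕ} (h : a ≤ b) : JJ F e b ≤ JJ F e a := by
  rw [JJ, Ideal.span_le]
  rintro x (rfl | ⟨i, rfl⟩)
  · exact sum_mem F e a
  · obtain ⟨k, rfl⟩ := Nat.exists_eq_add_of_le h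
    simp only [pow_add]
    exact Ideal.mul_mem_right _ _ (pow_mem' F e a i)

theorem finrank_mono (F : Type) [Field F] {e a b : ℕ} (h : a ≤ b)
    (hf : Module.Finite F (PP F ⧸ JJ F e b)) :
    Module.Finite F (PP F ⧸ JJ F e a) ∧
      Module.finrank F (PP F ⧸ JJ F e a) ≤ Module.finrank F (PP F ⧸ JJ F e b) := by
  let φ := (Ideal.Quotient.factorₐ F (JJ_anti F (e := e) h)).toLinearMap
  have hφ : Function.Surjective φ := Ideal.Quotient.factor_surjective (JJ_anti F h)
  exact ⟨Module.Finite.of_surjective φ hφ, LinearMap.finrank_le_finrank_of_surjective hφ⟩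

theorem sandwich (F : Type) [Field F] {m q : ℕ} (h1 : 4 * m ≤ q) (h2 : q ≤ 4 * (m + 1)) :
    64 * DD F m ≤ Module.finrank F (PP F ⧸ JJ F 4 q) ∧
      Module.finrank F (PP F ⧸ JJ F 4 q) ≤ 64 * DD F (m + 1) := by
  have k2 := finrank_mono F h2 (finite_four F (m + 1))
  have k1 := finrank_mono F h1 k2.1
  rw [finrank_four] at k1 k2
  exact ⟨k1.2, k2.2⟩

/-- The value of the colength in terms of the syzygy gap. -/
theorem gap_formula (p : ℕ) [Fact p.Prime] (hp : 3 ≤ p) (hodd : p % 2 = 1) {m n : ℕ} (hm : 1 ≤ m)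
    (hq : |4 * (m : ℤ) - (p : ℤ) ^ (n + 1)| ≤ 4) :
    ∃ g : ℤ, 0 ≤ g ∧ (64 * DD (ZMod p) m : ℤ) = 3 * (4 * m) ^ 2 + g ^ 2 ∧
      g ≤ p ^ n + 12 ∧ ((p % 8 = 1 ∨ p % 8 = 7) → g ≤ 12) ∧
      ((p % 8 = 3 ∨ p % 8 = 5) → (p : ℤ) ^ n - 12 ≤ g) := by
  obtain ⟨d, hS, hmin, hmd, h2⟩ := exists_min (ZMod p) hm
  have hD := DD_formula (ZMod p) hm hS hmin hmd h2
  have hu := upper_gap p hp hodd hm hS hq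
  refine ⟨4 * (3 * m - 2 * d), by omega, ?_, hu.1, hu.2, ?_⟩
  · zify at hD
    linear_combination 64 * hD
  · intro h
    obtain ⟨c, s, hs, hps⟩ : ∃ (c : ℕ) (s : ℤ), (s = 1 ∨ s = -1) ∧ (p : ℤ) = 4 * (2 * c + 1) + s := by
      rcases h with h | h
      · exact ⟨(p + 1) / 8, -1, Or.inr rfl, by omega⟩
      · exact ⟨(p - 1) / 8, 1, Or.inl rfl, by omega⟩
    have hc := exists_syz (ZMod p) (2 * c + 1) (3 * c + 1) (by omega) (by omega)
    set Q : ℕ := p ^ n with hQ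
    have hQ' : (p : ℤ) ^ n = Q := by rw [hQ]; push_cast; rfl
    rw [pow_succ, hQ', hps] at hq
    rw [hQ']
    obtain ⟨i, hi, hi4⟩ : ∃ i : ℕ, (m = (2 * c + 1) * Q + i ∨ m + i = (2 * c + 1) * Q) ∧
        4 * i ≤ Q + 4 := by
      set T := (2 * c + 1) * Q with hT
      have hT' : (Q : ℤ) * (4 * (2 * c + 1) + s) = 4 * T + s * Q := by
        rw [hT]; push_cast; ring
      rw [hT'] at hq
      have hq2 : |4 * (m : ℤ) - 4 * T| ≤ Q + 4 := by
        rw [abs_le] at hq ⊢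
        rcases hs with rfl | rfl <;> constructor <;> omega
      rw [abs_le] at hq2
      rcases Nat.le_total T m with h | h
      · exact ⟨m - T, Or.inl (by omega), by omega⟩
      · exact ⟨T - m, Or.inr (by omega), by omega⟩
    obtain ⟨d', hd', he⟩ := lower_gap p rfl hc i hi
    have : d ≤ d' := by
      by_contra hlt
      exact hmin d' (by omega) hd'
    rw [← hQ] at he
    omega

theorem hk_eq (p : ℕ) [Fact p.Prime] (q : ℕ) :
    hkColength (ZMod p) 3 ![4, 4, 4] q =
      Module.finrank (ZMod p) (PP (ZMod p) ⧸ JJ (ZMod p) 4 q) := by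
  have : ∀ i : Fin 3, (![4, 4, 4] : Fin 3 → ℕ) i = 4 := by
    intro i; fin_cases i <;> rfl
  have h2 : ∑ i : Fin 3, (X i : MvPolynomial (Fin 3) (ZMod p)) ^ (![4, 4, 4] : Fin 3 → ℕ) i =
      ∑ i : Fin 3, (X i : MvPolynomial (Fin 3) (ZMod p)) ^ 4 :=
    Finset.sum_congr rfl fun i _ => by rw [this]
  unfold hkColength JJ
  rw [h2]

theorem main_bound (p : ℕ) [Fact p.Prime] (hp : 3 ≤ p) (hodd : p % 2 = 1) (ε : ℝ)
    (hε : ((p % 8 = 3 ∨ p % 8 = 5) ∧ ε = 1 / p) ∨ ((p % 8 = 1 ∨ p % 8 = 7) ∧ ε = 0)) (n : ℕ)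
    (hn : 1 ≤ n) :
    3 * ((p : ℝ) ^ (n + 1) - 4) ^ 2 + (ε * (p : ℝ) ^ (n + 1) - 12) ^ 2 - 144 ≤
      hkColength (ZMod p) 3 ![4, 4, 4] (p ^ (n + 1)) ∧
    (hkColength (ZMod p) 3 ![4, 4, 4] (p ^ (n + 1)) : ℝ) ≤
      3 * ((p : ℝ) ^ (n + 1) + 4) ^ 2 + (ε * (p : ℝ) ^ (n + 1) + 12) ^ 2 := by
  rw [hk_eq]
  have hq9 : 9 ≤ p ^ (n + 1) := by
    calc 9 = 3 ^ 2 := by norm_num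
      _ ≤ p ^ 2 := Nat.pow_le_pow_left hp 2
      _ ≤ p ^ (n + 1) := Nat.pow_le_pow_right (by omega) (by omega)
  obtain ⟨hs1, hs2⟩ := sandwich (ZMod p) (m := p ^ (n + 1) / 4) (q := p ^ (n + 1))
    (by omega) (by omega)
  set m := p ^ (n + 1) / 4 with hm
  have hm4 : 4 * m ≤ p ^ (n + 1) ∧ p ^ (n + 1) ≤ 4 * m + 3 := by omega
  have hcast : (p : ℤ) ^ (n + 1) = ((p ^ (n + 1) : ℕ) : ℤ) := by push_cast; rfl
  obtain ⟨g1, hg1, e1, -, -, l1⟩ := gap_formula p hp hodd (m := m) (n := n) (by omega) (by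
    rw [hcast, abs_le]; omega)
  obtain ⟨g2, hg2, e2, u2, v2, -⟩ := gap_formula p hp hodd (m := m + 1) (n := n) (by omega) (by
    rw [hcast, abs_le]; push_cast; omega)
  have hp0 : (0 : ℝ) < p := by positivity
  have E1 : (64 * DD (ZMod p) m : ℝ) = 3 * (4 * m) ^ 2 + (g1 : ℝ) ^ 2 := by exact_mod_cast e1
  have E2 : (64 * DD (ZMod p) (m + 1) : ℝ) = 3 * (4 * (m + 1)) ^ 2 + (g2 : ℝ) ^ 2 := by
    exact_mod_cast e2
  have S1 : (64 * DD (ZMod p) m : ℝ) ≤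
      (Module.finrank (ZMod p) (PP (ZMod p) ⧸ JJ (ZMod p) 4 (p ^ (n + 1))) : ℝ) := by
    exact_mod_cast hs1
  have S2 : (Module.finrank (ZMod p) (PP (ZMod p) ⧸ JJ (ZMod p) 4 (p ^ (n + 1))) : ℝ) ≤
      (64 * DD (ZMod p) (m + 1) : ℝ) := by exact_mod_cast hs2
  have M1 : (p : ℝ) ^ (n + 1) - 4 ≤ 4 * m := by
    have : ((p ^ (n + 1) : ℕ) : ℝ) ≤ 4 * m + 3 := by exact_mod_cast hm4.2
    push_cast at this; linarith
  have M2 : (4 : ℝ) * (m + 1) ≤ (p : ℝ) ^ (n + 1) + 4 := by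
    have : (4 * m : ℝ) ≤ ((p ^ (n + 1) : ℕ) : ℝ) := by exact_mod_cast hm4.1
    push_cast at this; linarith
  have Q9 : (9 : ℝ) ≤ (p : ℝ) ^ (n + 1) := by exact_mod_cast hq9
  have G1 : (0 : ℝ) ≤ g1 := by exact_mod_cast hg1
  have G2 : (0 : ℝ) ≤ g2 := by exact_mod_cast hg2
  have A1 : ((p : ℝ) ^ (n + 1) - 4) ^ 2 ≤ (4 * m) ^ 2 := by
    apply pow_le_pow_left₀ _ M1; linarith
  have A2 : (4 * ((m : ℝ) + 1)) ^ 2 ≤ ((p : ℝ) ^ (n + 1) + 4) ^ 2 := by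
    apply pow_le_pow_left₀ _ M2; positivity
  have B : (ε * (p : ℝ) ^ (n + 1) - 12) ^ 2 - 144 ≤ (g1 : ℝ) ^ 2 ∧
      (g2 : ℝ) ^ 2 ≤ (ε * (p : ℝ) ^ (n + 1) + 12) ^ 2 := by
    rcases hε with ⟨h, rfl⟩ | ⟨h, rfl⟩
    · have hQ : 1 / (p : ℝ) * (p : ℝ) ^ (n + 1) = (p : ℝ) ^ n := by
        rw [pow_succ]; field_simp
      rw [hQ]
      have L : (p : ℝ) ^ n - 12 ≤ g1 := by exact_mod_cast l1 h
      have U : (g2 : ℝ) ≤ (p : ℝ) ^ n + 12 := by exact_mod_cast u2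
      have hpos : (0 : ℝ) < (p : ℝ) ^ n := by positivity
      constructor
      · rcases le_total 12 ((p : ℝ) ^ n) with h | h
        · have := pow_le_pow_left₀ (by linarith) L 2
          linarith
        · nlinarith
      · exact pow_le_pow_left₀ G2 U 2
    · have U : (g2 : ℝ) ≤ 12 := by exact_mod_cast v2 h
      constructor
      · nlinarith
      · rw [zero_mul, zero_add]; exact pow_le_pow_left₀ G2 U 2
  constructor
  · linarith [B.1]
  · linarith [B.2]

theorem main_tendsto (p : ℕ) [Fact p.Prime] (hp : 3 ≤ p) (hodd : p % 2 = 1) (ε : ℝ)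
    (hε : ((p % 8 = 3 ∨ p % 8 = 5) ∧ ε = 1 / p) ∨ ((p % 8 = 1 ∨ p % 8 = 7) ∧ ε = 0)) :
    Filter.Tendsto
      (fun n : ℕ => (hkColength (ZMod p) 3 ![4, 4, 4] (p ^ n) : ℝ) / ((p : ℝ) ^ n) ^ 2)
      Filter.atTop (nhds (3 + ε ^ 2)) := by
  have hp1 : (1 : ℝ) < p := by exact_mod_cast (by omega : 1 < p)
  have hx : Filter.Tendsto (fun n : ℕ => ((p : ℝ) ^ n)⁻¹) Filter.atTop (nhds 0) :=
    tendsto_inv_atTop_zero.comp (tendsto_pow_atTop_atTop_of_one_lt hp1)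
  have hlo : Filter.Tendsto (fun n : ℕ => 3 * (1 - 4 * ((p : ℝ) ^ n)⁻¹) ^ 2 +
      (ε - 12 * ((p : ℝ) ^ n)⁻¹) ^ 2 - 144 * ((p : ℝ) ^ n)⁻¹ ^ 2) Filter.atTop
      (nhds (3 + ε ^ 2)) := by
    have hc : Continuous (fun x : ℝ => 3 * (1 - 4 * x) ^ 2 + (ε - 12 * x) ^ 2 - 144 * x ^ 2) := by
      fun_prop
    have h0 := (hc.tendsto 0).comp hx
    simp only [mul_zero, sub_zero, add_zero, one_pow, mul_one, ne_eq, OfNat.ofNat_ne_zero,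
      not_false_eq_true, zero_pow] at h0
    exact h0

  have hhi : Filter.Tendsto (fun n : ℕ => 3 * (1 + 4 * ((p : ℝ) ^ n)⁻¹) ^ 2 +
      (ε + 12 * ((p : ℝ) ^ n)⁻¹) ^ 2) Filter.atTop (nhds (3 + ε ^ 2)) := by
    have hc : Continuous (fun x : ℝ => 3 * (1 + 4 * x) ^ 2 + (ε + 12 * x) ^ 2) := by
      fun_prop
    have h0 := (hc.tendsto 0).comp hx
    simp only [mul_zero, sub_zero, add_zero, one_pow, mul_one, ne_eq, OfNat.ofNat_ne_zero,
      not_false_eq_true, zero_pow] at h0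
    exact h0

  refine tendsto_of_tendsto_of_tendsto_of_le_of_le' hlo hhi ?_ ?_
  · filter_upwards [eventually_ge_atTop 2] with n hn
    obtain ⟨k, rfl⟩ : ∃ k, n = k + 1 := ⟨n - 1, by omega⟩
    have hb := (main_bound p hp hodd ε hε k (by omega)).1
    have hpos : (0 : ℝ) < (p : ℝ) ^ (k + 1) := by positivity
    rw [le_div_iff₀ (by positivity)]
    refine le_trans (le_of_eq ?_) hb
    generalize (p : ℝ) ^ (k + 1) = q at *
    field_simp
  · filter_upwards [eventually_ge_atTop 2] with n hn
    obtain ⟨k, rfl⟩ : ∃ k, n = k + 1 := ⟨n - 1, by omega⟩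
    have hb := (main_bound p hp hodd ε hε k (by omega)).2
    have hpos : (0 : ℝ) < (p : ℝ) ^ (k + 1) := by positivity
    rw [div_le_iff₀ (by positivity)]
    refine le_trans hb (le_of_eq ?_)
    generalize (p : ℝ) ^ (k + 1) = q at *
    field_simp

end HK

/-- Monsky: for an odd prime `p`, `R = (ℤ/pℤ)[x,y,z]/(x⁴+y⁴+z⁴)` and
`I = (x,y,z)`, the Hilbert–Kunz multiplicity
`e_HK(I,R) = lim_n dim (R/I^{[pⁿ]})/p^{2n}` exists and equals `3 + 1/p²` when
`p ≡ 3, 5 (mod 8)` and `3` when `p ≡ 1, 7 (mod 8)`; in particular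
`e_HK(I,R) = 3 + O(1/p²)`. -/
theorem statement14 :
    ∃ C > (0:ℝ), ∀ p : ℕ, p.Prime → Odd p →
      ∃ e : ℝ,
        Filter.Tendsto
          (fun n : ℕ => (hkColength (ZMod p) 3 ![4, 4, 4] (p ^ n) : ℝ) / ((p : ℝ) ^ n) ^ 2)
          Filter.atTop (nhds e) ∧
        ((p % 8 = 3 ∨ p % 8 = 5) → e = 3 + 1 / (p : ℝ) ^ 2) ∧
        ((p % 8 = 1 ∨ p % 8 = 7) → e = 3) ∧
        |e - 3| ≤ C / (p : ℝ) ^ 2 := by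
  refine ⟨1, one_pos, ?_⟩
  intro p hp hodd
  have : Fact p.Prime := ⟨hp⟩
  have hodd' : p % 2 = 1 := Nat.odd_iff.1 hodd
  have hp3 : 3 ≤ p := by
    have := hp.two_le
    omega
  have h8 : (p % 8 = 3 ∨ p % 8 = 5) ∨ (p % 8 = 1 ∨ p % 8 = 7) := by omega
  have hp0 : (0 : ℝ) < p := by positivity
  rcases h8 with h | h
  · have ht := HK.main_tendsto p hp3 hodd' (1 / p) (Or.inl ⟨h, rfl⟩)
    refine ⟨3 + 1 / (p : ℝ) ^ 2, ?_, fun _ => rfl, fun h' => by omega, ?_⟩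
    · rwa [one_div, inv_pow, ← one_div] at ht
    · rw [add_sub_cancel_left, abs_of_pos (by positivity)]
  · have ht := HK.main_tendsto p hp3 hodd' 0 (Or.inr ⟨h, rfl⟩)
    refine ⟨3, ?_, fun h' => by omega, fun _ => rfl, ?_⟩
    · simpa using ht
    · rw [sub_self, abs_zero]; positivity
end
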